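/- Let f be an entire function of finite order ρ(f) and let ε > 0. Suppose that the set {z ∈ Δ : |z f'(z)/f(z)| < |z|^{ρ(f)/2+ε} or |f(z)| < (1+ε)|z|} has finite logarithmic area. Then logarea(Δ \ I(f)) < ∞; in particular, area I(f) > 0. If, in addition, the Fatou set F(f) has no multiply connected component, then logarea(Δ \ (I(f) ∩ J(f))) < ∞, and thus area(I(f) ∩ J(f)) > 0. -/

import Mathlib

open MeasureTheory Filter Metric Set Topology ENNReal

/-- Logarithmic area of a subset of the plane. -/
noncomputable def logArea (A : Set ℂ) : ℝ≥0∞ :=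
  ∫⁻ z in A, ENNReal.ofReal ((‖z‖ ^ 2)⁻¹)

/-- The set Δ = {z : |z| ≥ 1}. -/
def Delta : Set ℂ := {z : ℂ | 1 ≤ ‖z‖}

/-- Chordal (spherical) distance on the Riemann sphere ℂ ∪ {∞}, with ∞ encoded as `none`. -/
noncomputable def chordalDist : Option ℂ → Option ℂ → ℝ
  | none, none => 0
  | none, some w => 2 / Real.sqrt (1 + ‖w‖ ^ 2)
  | some z, none => 2 / Real.sqrt (1 + ‖z‖ ^ 2)
  | some z, some w =>
      2 * ‖z - w‖ / (Real.sqrt (1 + ‖z‖ ^ 2) * Real.sqrt (1 + ‖w‖ ^ 2))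

/-- Locally uniform convergence on `U` of a sequence of ℂ-valued functions towards a
function with values in the Riemann sphere, with respect to the spherical metric. -/
def SphLocUnifConvOn (F : ℕ → ℂ → ℂ) (g : ℂ → Option ℂ) (U : Set ℂ) : Prop :=
  ∀ K : Set ℂ, K ⊆ U → IsCompact K → ∀ ε : ℝ, 0 < ε →
    ∀ᶠ n in atTop, ∀ z ∈ K, chordalDist (some (F n z)) (g z) < ε

/-- The Fatou set: points having a neighborhood on which every sequence of iterates has a
subsequence converging locally uniformly with respect to the spherical metric. -/
def fatouSet (f : ℂ → ℂ) : Set ℂ :=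
  {z | ∃ U ∈ 𝓝 z, ∀ φ : ℕ → ℕ, StrictMono φ →
    ∃ ψ : ℕ → ℕ, StrictMono ψ ∧ ∃ g : ℂ → Option ℂ,
      SphLocUnifConvOn (fun n => f^[φ (ψ n)]) g U}

/-- The Julia set. -/
def juliaSet (f : ℂ → ℂ) : Set ℂ := (fatouSet f)ᶜ

/-- The escaping set. -/
def escapingSet (f : ℂ → ℂ) : Set ℂ :=
  {z | Tendsto (fun n => ‖f^[n] z‖) atTop atTop}

/-- The Fatou set has no multiply connected component. -/
def NoMultiplyConnectedFatouComponent (f : ℂ → ℂ) : Prop :=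
  ∀ z ∈ fatouSet f, SimplyConnectedSpace (connectedComponentIn (fatouSet f) z)

/-- Maximum modulus M(r,f). -/
noncomputable def maxMod (f : ℂ → ℂ) (r : ℝ) : ℝ :=
  sSup ((fun z => ‖f z‖) '' {z : ℂ | ‖z‖ = r})

/-- The order ρ(f) of an entire function, as an extended real number. -/
noncomputable def entireOrder (f : ℂ → ℂ) : EReal :=
  limsup (fun r : ℝ => ((Real.log (Real.log (maxMod f r)) / Real.log r : ℝ) : EReal)) atTop

/-- The fast escaping set A(f). -/
def fastEscapingSet (f : ℂ → ℂ) : Set ℂ :=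
  {z | ∃ R : ℝ, 0 < R ∧ (∀ r : ℝ, R ≤ r → r < maxMod f r) ∧
    ∃ L : ℕ, ∀ n : ℕ, L < n → (maxMod f)^[n - L] R ≤ ‖f^[n] z‖}

/-- `f` is a transcendental entire function. -/
def TranscendentalEntire (f : ℂ → ℂ) : Prop :=
  Differentiable ℂ f ∧ ¬ ∃ p : Polynomial ℂ, ∀ z, f z = p.eval z

/-- Order of vanishing of `g` at `z` (the least `k` with nonzero `k`-th derivative). -/
noncomputable def vanishingOrder (g : ℂ → ℂ) (z : ℂ) : ℕ :=
  sInf {k : ℕ | iteratedDeriv k g z ≠ 0}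

/-- n(r,a): the number of solutions of f(z) = a with |z| ≤ r, counted with multiplicity. -/
noncomputable def nCount (f : ℂ → ℂ) (a : ℂ) (r : ℝ) : ℕ :=
  ∑ᶠ z ∈ {z : ℂ | ‖z‖ ≤ r ∧ f z = a}, vanishingOrder (fun w => f w - a) z

/-- n(r) = max over a of n(r,a). -/
noncomputable def nMax (f : ℂ → ℂ) (r : ℝ) : ℕ := ⨆ a : ℂ, nCount f a r

/-- Critical values of `f`. -/
def criticalValues (f : ℂ → ℂ) : Set ℂ := {w | ∃ z, deriv f z = 0 ∧ f z = w}

/-- Finite asymptotic values of `f`. -/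
def asymptoticValues (f : ℂ → ℂ) : Set ℂ :=
  {w | ∃ γ : ℝ → ℂ, Continuous γ ∧ Tendsto (fun t => ‖γ t‖) atTop atTop ∧
    Tendsto (fun t => f (γ t)) atTop (𝓝 w)}

/-- The Eremenko–Lyubich class B. -/
def ELClass (f : ℂ → ℂ) : Prop :=
  TranscendentalEntire f ∧ Bornology.IsBounded (criticalValues f ∪ asymptoticValues f)

/-- Semihyperbolic polynomial. -/
def SemiHyperbolic (p : Polynomial ℂ) : Prop :=
  ∃ ε : ℝ, 0 < ε ∧ ∃ N : ℕ, ∀ z ∈ juliaSet (fun w => p.eval w), ∀ n : ℕ, 1 ≤ n →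
    ∀ V : Set ℂ, (∃ u ∈ (fun w => p.eval w)^[n] ⁻¹' ball z ε,
        V = connectedComponentIn ((fun w => p.eval w)^[n] ⁻¹' ball z ε) u) →
      ∀ w ∈ ball z ε,
        (∑ᶠ u ∈ {u : ℂ | u ∈ V ∧ (fun v => p.eval v)^[n] u = w},
          vanishingOrder (fun ζ => (fun v => p.eval v)^[n] ζ - w) u) ≤ N

/-- Continuous branches of the logarithm are holomorphic. -/
theorem hasDerivAt_of_exp_eq {U : Set ℂ} (hU : IsOpen U) {L g : ℂ → ℂ} {g' z : ℂ}
    (hL : ContinuousOn L U) (he : ∀ w ∈ U, Complex.exp (L w) = g w) (hz : z ∈ U)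
    (hg : HasDerivAt g g' z) : HasDerivAt L (g' / g z) z := by
  have hUz : U ∈ 𝓝 z := hU.mem_nhds hz
  have hLc : ContinuousAt L z := hL.continuousAt hUz
  have hstrict : HasStrictDerivAt Complex.exp (g z) (L z) := by
    have := Complex.hasStrictDerivAt_exp (L z)
    rwa [he z hz] at this
  have hgz : g z ≠ 0 := by rw [← he z hz]; exact Complex.exp_ne_zero _
  have hinv := hstrict.to_localInverse hgz
  rw [he z hz] at hinv
  have h3 : HasDerivAt _ _ z := HasDerivAt.comp z hinv.hasDerivAt hg
  refine (h3.congr_of_eventuallyEq ?_).congr_deriv ?_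
  · have h2 := (hstrict.hasStrictFDerivAt_equiv hgz).eventually_left_inverse
    filter_upwards [hLc.eventually h2, hUz] with w hw hwU
    rw [Function.comp_apply, ← he w hwU]
    exact hw.symm
  · field_simp

/-- A Jensen-type bound for the number of zeros in a disc. -/
theorem two_pow_card_zeros_mul_norm_le {r M : ℝ} (hr : 0 < r) (T : Finset ℂ) :
    ∀ g : ℂ → ℂ, Differentiable ℂ g → (∀ z, ‖z‖ = 3 * r → ‖g z‖ ≤ M) →
      (∀ z ∈ T, ‖z‖ ≤ r ∧ g z = 0) → 2 ^ T.card * ‖g 0‖ ≤ M := by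
  induction T using Finset.induction_on generalizing M with
  | empty =>
    intro g hg hM _
    simp only [Finset.card_empty, pow_zero, one_mul]
    refine Complex.norm_le_of_forall_mem_frontier_norm_le (U := ball (0 : ℂ) (3 * r))
      isBounded_ball hg.diffContOnCl ?_ (subset_closure (mem_ball_self (by positivity)))
    intro z hz
    rw [frontier_ball _ (by positivity)] at hz
    exact hM z (by simpa using hz)
  | insert a T ha ih =>
    intro g hg hM hz
    have hga : g a = 0 := (hz a (by simp)).2
    have har : ‖a‖ ≤ r := (hz a (by simp)).1
    have hd : Differentiable ℂ (dslope g a) := by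
      have := (Complex.differentiableOn_dslope (s := univ) (c := a) univ_mem (f := g)).2
        hg.differentiableOn
      exact differentiableOn_univ.1 this
    have hfac : ∀ w, (w - a) * dslope g a w = g w := by
      intro w
      have := sub_smul_dslope g a w
      simpa [hga] using this
    have key := ih (M := M / (2 * r)) (dslope g a) hd (by
      intro z hz3
      rw [le_div_iff₀ (by positivity)]
      have h1 : 2 * r ≤ ‖z - a‖ := by
        have := norm_sub_norm_le z a
        linarith
      have h2 := hM z hz3
      rw [← hfac z, norm_mul] at h2
      nlinarith [norm_nonneg (dslope g a z)]) (by
      intro z hzT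
      have hzz := hz z (by simp [hzT])
      refine ⟨hzz.1, ?_⟩
      have h1 := hfac z
      rw [hzz.2] at h1
      rcases mul_eq_zero.1 h1 with h | h
      · exact absurd (sub_eq_zero.1 h ▸ hzT) ha
      · exact h)
    rw [Finset.card_insert_of_notMem ha, pow_succ, ← hfac 0, norm_mul]
    rw [le_div_iff₀ (by positivity)] at key
    have h0 : ‖(0 : ℂ) - a‖ ≤ r := by simpa using har
    calc 2 ^ T.card * 2 * (‖(0 : ℂ) - a‖ * ‖dslope g a 0‖)
        ≤ 2 ^ T.card * 2 * (r * ‖dslope g a 0‖) := by gcongr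
      _ = 2 ^ T.card * ‖dslope g a 0‖ * (2 * r) := by ring
      _ ≤ M := key

/-- A weak form of Bloch's theorem. -/
theorem exists_ball_subset_image_of_deriv {h : ℂ → ℂ} {z : ℂ} {δ : ℝ} (hδ : 0 < δ)
    (hh : DifferentiableOn ℂ h (ball z δ)) (hne : deriv h z ≠ 0) :
    ∃ v : ℂ, ball v (‖deriv h z‖ * δ / 96) ⊆ h '' ball z δ := by
  have hd : DifferentiableOn ℂ (deriv h) (ball z δ) := hh.deriv isOpen_ball
  obtain ⟨η, hη⟩ : ∃ η, η = δ / 2 := ⟨_, rfl⟩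
  have hη0 : 0 < η := by linarith
  have hsub : closedBall z η ⊆ ball z δ := closedBall_subset_ball (by linarith)
  obtain ⟨a, ha, hmax⟩ := (isCompact_closedBall z η).exists_isMaxOn
    (f := fun t => ‖deriv h t‖ * (η - dist t z)) ⟨z, mem_closedBall_self hη0.le⟩
    ((hd.continuousOn.mono hsub).norm.mul (by fun_prop))
  have hza : ‖deriv h z‖ * η ≤ ‖deriv h a‖ * (η - dist a z) := by
    simpa using hmax (mem_closedBall_self hη0.le)
  have hpos : 0 < ‖deriv h a‖ * (η - dist a z) :=
    lt_of_lt_of_le (mul_pos (norm_pos_iff.2 hne) hη0) hza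
  have haz : 0 < η - dist a z := pos_of_mul_pos_right hpos (norm_nonneg _)
  have hda : 0 < ‖deriv h a‖ := pos_of_mul_pos_left hpos haz.le
  obtain ⟨s, hs⟩ : ∃ s, s = (η - dist a z) / 2 := ⟨_, rfl⟩
  have hs0 : 0 < s := by linarith
  have hball : ball a s ⊆ closedBall z η := by
    intro t ht
    have := dist_triangle t a z
    simp only [mem_ball, mem_closedBall] at ht ⊢
    linarith
  have hbd : ∀ t ∈ ball a s, ‖deriv h t‖ ≤ 2 * ‖deriv h a‖ := by
    intro t ht
    have h1 : ‖deriv h t‖ * (η - dist t z) ≤ ‖deriv h a‖ * (η - dist a z) := hmax (hball ht)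
    have h2 : s ≤ η - dist t z := by
      have := dist_triangle t a z
      simp only [mem_ball] at ht
      linarith
    have h3 : η - dist a z = 2 * s := by linarith
    rw [h3] at h1
    have h4 : ‖deriv h t‖ * s ≤ (2 * ‖deriv h a‖) * s := by
      nlinarith [norm_nonneg (deriv h t)]
    exact le_of_mul_le_mul_right h4 hs0
  have hdiff : ∀ t ∈ ball a s, ‖deriv h t - deriv h a‖ ≤ 3 * ‖deriv h a‖ / s * dist t a := by
    intro t ht
    rw [← dist_eq_norm]
    refine Complex.dist_le_div_mul_dist_of_mapsTo_ball (hd.mono (hball.trans hsub)) ?_ ht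
    intro u hu
    rw [mem_closedBall, dist_eq_norm]
    have := norm_sub_le (deriv h u) (deriv h a)
    have := hbd u hu
    linarith
  have hsubs : closedBall a (s / 6) ⊆ ball a s := closedBall_subset_ball (by linarith)
  have hest : ∀ t ∈ closedBall a (s / 6),
      ‖(h t - deriv h a * t) - (h a - deriv h a * a)‖ ≤ ‖deriv h a‖ / 2 * ‖t - a‖ := by
    intro t ht
    refine Convex.norm_image_sub_le_of_norm_hasDerivWithin_le (s := closedBall a (s / 6))
      (f := fun t => h t - deriv h a * t) (f' := fun t => deriv h t - deriv h a) ?_ ?_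
      (convex_closedBall _ _) (mem_closedBall_self (by positivity)) ht
    · intro x hx
      have hx' := hsub (hball (hsubs hx))
      have h1 : HasDerivAt h (deriv h x) x :=
        (hh.differentiableAt (isOpen_ball.mem_nhds hx')).hasDerivAt
      simpa using (h1.fun_sub ((hasDerivAt_id x).const_mul (deriv h a))).hasDerivWithinAt
    · intro x hx
      refine (hdiff x (hsubs hx)).trans ?_
      rw [mem_closedBall] at hx
      calc 3 * ‖deriv h a‖ / s * dist x a ≤ 3 * ‖deriv h a‖ / s * (s / 6) := by gcongr
        _ = ‖deriv h a‖ / 2 := by field_simp; norm_num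
  have hsphere : ∀ t ∈ sphere a (s / 6), ‖deriv h a‖ * s / 12 ≤ ‖h t - h a‖ := by
    intro t ht
    have h1 := hest t (sphere_subset_closedBall ht)
    have h2 : ‖t - a‖ = s / 6 := by simpa [dist_eq_norm] using ht
    have h3 : ‖deriv h a * (t - a)‖ = ‖deriv h a‖ * (s / 6) := by rw [norm_mul, h2]
    have h4 : deriv h a * (t - a) =
      (h t - h a) - ((h t - deriv h a * t) - (h a - deriv h a * a)) := by ring
    rw [h4] at h3
    have h5 := norm_sub_le (h t - h a) ((h t - deriv h a * t) - (h a - deriv h a * a))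
    rw [h2] at h1
    linarith
  have hdc : DiffContOnCl ℂ h (ball a (s / 6)) := by
    refine DifferentiableOn.diffContOnCl ?_
    rw [closure_ball _ (by positivity)]
    exact hh.mono (hsubs.trans (hball.trans hsub))
  have himg := hdc.ball_subset_image_closedBall (by positivity) hsphere (by
    have h1 : HasDerivAt h (deriv h a) a :=
      (hh.differentiableAt (isOpen_ball.mem_nhds (hsub ha))).hasDerivAt
    have h2 := h1.eventually_ne (c := h a) (norm_pos_iff.1 hda)
    exact h2.frequently.filter_mono nhdsWithin_le_nhds)
  refine ⟨h a, (ball_subset_ball ?_).trans (himg.trans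
    (image_mono (hsubs.trans (hball.trans hsub))))⟩
  have : η - dist a z = 2 * s := by linarith
  rw [this, hη] at hza
  linarith

/-- The logarithmic area as a measure. -/
noncomputable def logMeasure : Measure ℂ :=
  volume.withDensity fun z => ENNReal.ofReal ((‖z‖ ^ 2)⁻¹)

theorem logMeasure_apply (A : Set ℂ) : logMeasure A = logArea A :=
  withDensity_apply' _ A

theorem mul_volume_le_logMeasure {A : Set ℂ} {r : ℝ} (hA : MeasurableSet A)
    (h : ∀ z ∈ A, 0 < ‖z‖ ∧ ‖z‖ ≤ r) :
    ENNReal.ofReal ((r ^ 2)⁻¹) * volume A ≤ logMeasure A := by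
  rw [logMeasure_apply, logArea, ← setLIntegral_const]
  refine setLIntegral_mono' hA fun z hz => ENNReal.ofReal_le_ofReal ?_
  obtain ⟨h1, h2⟩ := h z hz
  gcongr

/-- A set which contains all large dilates of a disc has infinite logarithmic area. -/
theorem logMeasure_eq_top_of_cone {E : Set ℂ} {z₁ : ℂ} {δ T : ℝ} (hz₁ : z₁ ≠ 0) (hδ : 0 < δ)
    (hE : ∀ t : ℝ, T ≤ t → ∀ ζ ∈ ball z₁ δ, (t : ℂ) * ζ ∈ E) : logMeasure E = ⊤ := by
  wlog hδ' : δ < ‖z₁‖ / 2 generalizing δ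
  · have hz : 0 < ‖z₁‖ := norm_pos_iff.2 hz₁
    refine this (δ := min δ (‖z₁‖ / 4)) (lt_min hδ (by positivity)) ?_ ?_
    · exact fun t ht ζ hζ => hE t ht ζ (ball_subset_ball (min_le_left _ _) hζ)
    · exact (min_le_right _ _).trans_lt (by linarith)
  have hz : 0 < ‖z₁‖ := norm_pos_iff.2 hz₁
  obtain ⟨k₀, hk₀⟩ := pow_unbounded_of_one_lt T (show (1 : ℝ) < 4 by norm_num)
  set B : ℕ → Set ℂ := fun k => ball ((4 ^ (k₀ + k) : ℝ) * z₁) (4 ^ (k₀ + k) * δ) with hB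
  have hpos : ∀ k : ℕ, (0 : ℝ) < 4 ^ (k₀ + k) := fun k => by positivity
  have hnorm : ∀ k, ∀ z ∈ B k, 4 ^ (k₀ + k) * (‖z₁‖ / 2) < ‖z‖ ∧
      ‖z‖ < 4 ^ (k₀ + k) * (2 * ‖z₁‖) := by
    intro k z hzB
    have h1 : ‖z - (4 ^ (k₀ + k) : ℝ) * z₁‖ < 4 ^ (k₀ + k) * δ := by
      simpa [hB, dist_eq_norm] using hzB
    have h2 : ‖((4 ^ (k₀ + k) : ℝ) : ℂ) * z₁‖ = 4 ^ (k₀ + k) * ‖z₁‖ := by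
      rw [norm_mul, Complex.norm_real, Real.norm_of_nonneg (hpos k).le]
    have h3 := norm_sub_norm_le (((4 ^ (k₀ + k) : ℝ) : ℂ) * z₁) z
    rw [norm_sub_rev] at h3
    have h4 := norm_sub_norm_le z (((4 ^ (k₀ + k) : ℝ) : ℂ) * z₁)
    have h5 := mul_lt_mul_of_pos_left hδ' (hpos k)
    have h6 := mul_pos (hpos k) hz
    constructor <;> nlinarith
  have hBE : ∀ k, B k ⊆ E := by
    intro k z hzB
    have h1 : ‖z - (4 ^ (k₀ + k) : ℝ) * z₁‖ < 4 ^ (k₀ + k) * δ := by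
      simpa [hB, dist_eq_norm] using hzB
    have hne : ((4 ^ (k₀ + k) : ℝ) : ℂ) ≠ 0 := by exact_mod_cast (hpos k).ne'
    have := hE (4 ^ (k₀ + k)) (hk₀.le.trans
      (pow_le_pow_right₀ (by norm_num) (by omega))) (z / (4 ^ (k₀ + k) : ℝ)) (by
        rw [mem_ball, dist_eq_norm]
        have h2 : z - (4 ^ (k₀ + k) : ℝ) * z₁ =
          (4 ^ (k₀ + k) : ℝ) * (z / (4 ^ (k₀ + k) : ℝ) - z₁) := by
            rw [mul_sub, mul_div_cancel₀ _ hne]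
        rw [h2, norm_mul, Complex.norm_real, Real.norm_of_nonneg (hpos k).le] at h1
        exact lt_of_mul_lt_mul_left h1 (hpos k).le)
    rwa [mul_div_cancel₀ _ hne] at this
  have hdisj : Pairwise (Function.onFun Disjoint B) := by
    have aux : ∀ i j, i < j → Disjoint (B i) (B j) := by
      intro i j hij
      rw [Set.disjoint_left]
      intro z hi hj
      have h1 := (hnorm i z hi).2
      have h2 := (hnorm j z hj).1
      have h3 : (4 : ℝ) ^ (k₀ + i) * 4 ≤ 4 ^ (k₀ + j) := by
        rw [← pow_succ]
        exact pow_le_pow_right₀ (by norm_num) (by omega)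
      nlinarith
    intro i j hij
    rcases lt_or_gt_of_ne hij with h | h
    · exact aux i j h
    · exact (aux j i h).symm
  have hlow : ∀ k, ENNReal.ofReal (((2 * ‖z₁‖) ^ 2)⁻¹ * δ ^ 2) * NNReal.pi ≤ logMeasure (B k) := by
    intro k
    refine le_trans (le_of_eq ?_) (mul_volume_le_logMeasure (r := 4 ^ (k₀ + k) * (2 * ‖z₁‖))
      measurableSet_ball fun z hzB => ⟨?_, (hnorm k z hzB).2.le⟩)
    · rw [Complex.volume_ball, ← mul_assoc, ← ENNReal.ofReal_pow (by positivity),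
        ← ENNReal.ofReal_mul (by positivity)]
      congr 2
      have := (hpos k).ne'
      field_simp
    · exact lt_trans (mul_pos (hpos k) (by positivity)) (hnorm k z hzB).1
  have hsum : ∑' k, logMeasure (B k) = ⊤ := by
    refine top_unique (le_trans (le_of_eq ?_) (ENNReal.tsum_le_tsum hlow))
    refine (ENNReal.tsum_const_eq_top_of_ne_zero ?_).symm
    refine mul_ne_zero ?_ (by simpa using NNReal.pi_ne_zero)
    have : 0 < ((2 * ‖z₁‖) ^ 2)⁻¹ * δ ^ 2 := by positivity
    simpa using this
  rw [← measure_iUnion hdisj fun k => measurableSet_ball] at hsum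
  exact top_unique (hsum ▸ measure_mono (iUnion_subset hBE))

theorem logMeasure_eq_top_of_norm_ge {E : Set ℂ} {R : ℝ} (hE : ∀ z, R ≤ ‖z‖ → z ∈ E) :
    logMeasure E = ⊤ := by
  refine logMeasure_eq_top_of_cone (z₁ := 1) (δ := 1 / 2) (T := 2 * |R|) one_ne_zero (by norm_num) ?_
  intro t ht ζ hζ
  apply hE
  have h1 : ‖ζ - 1‖ < 1 / 2 := by simpa [dist_eq_norm] using hζ
  have h2 := norm_sub_norm_le (1 : ℂ) ζ
  rw [norm_sub_rev, norm_one] at h2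
  have ht0 : 0 ≤ t := le_trans (by positivity) ht
  rw [norm_mul, Complex.norm_real, Real.norm_of_nonneg ht0]
  nlinarith [le_abs_self R, abs_nonneg R]

theorem logMeasure_bounded_annulus_lt_top (R : ℝ) :
    logMeasure {z : ℂ | 1 ≤ ‖z‖ ∧ ‖z‖ < R} < ⊤ := by
  rw [logMeasure_apply, logArea]
  have hm : MeasurableSet {z : ℂ | 1 ≤ ‖z‖ ∧ ‖z‖ < R} :=
    (measurableSet_le measurable_const measurable_norm).inter
      (measurableSet_lt measurable_norm measurable_const)
  calc ∫⁻ z in {z : ℂ | 1 ≤ ‖z‖ ∧ ‖z‖ < R}, ENNReal.ofReal ((‖z‖ ^ 2)⁻¹)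
      ≤ ∫⁻ _ in {z : ℂ | 1 ≤ ‖z‖ ∧ ‖z‖ < R}, 1 := by
        refine setLIntegral_mono' hm fun z hz => ?_
        rw [← ENNReal.ofReal_one]
        exact ENNReal.ofReal_le_ofReal (inv_le_one_of_one_le₀ (one_le_pow₀ hz.1))
    _ = volume {z : ℂ | 1 ≤ ‖z‖ ∧ ‖z‖ < R} := by simp
    _ ≤ volume (ball (0 : ℂ) R) := measure_mono fun z hz => by simpa using hz.2
    _ < ⊤ := measure_ball_lt_top

theorem norm_le_maxMod {f : ℂ → ℂ} (hf : Continuous f) (z : ℂ) : ‖f z‖ ≤ maxMod f ‖z‖ := by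
  refine le_csSup ?_ ⟨z, rfl, rfl⟩
  have : {w : ℂ | ‖w‖ = ‖z‖} = sphere 0 ‖z‖ := by ext w; simp
  rw [this]
  exact ((isCompact_sphere _ _).image (by fun_prop : Continuous fun w => ‖f w‖)).bddAbove

theorem exists_norm_le_exp_rpow {f : ℂ → ℂ} (hf : Continuous f) {ρ κ : ℝ}
    (hord : entireOrder f = (ρ : EReal)) (hκ : ρ < κ) :
    ∃ R : ℝ, 1 < R ∧ ∀ z, R ≤ ‖z‖ → ‖f z‖ ≤ Real.exp (‖z‖ ^ κ) := by
  have h1 : entireOrder f < (κ : EReal) := by rw [hord]; exact_mod_cast hκ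
  have h2 := eventually_lt_of_limsup_lt h1
  obtain ⟨R, hR⟩ := eventually_atTop.1 h2
  refine ⟨max R 2, by simp, fun z hz => ?_⟩
  have hz2 : 2 ≤ ‖z‖ := (le_max_right _ _).trans hz
  have h3 := hR ‖z‖ ((le_max_left _ _).trans hz)
  rw [EReal.coe_lt_coe_iff] at h3
  have hlog : 0 < Real.log ‖z‖ := Real.log_pos (by linarith)
  rw [div_lt_iff₀ hlog] at h3
  refine (norm_le_maxMod hf z).trans ?_
  have hrp : 0 < ‖z‖ ^ κ := Real.rpow_pos_of_pos (by linarith) _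
  rcases le_or_gt (maxMod f ‖z‖) 1 with hM | hM
  · exact hM.trans (Real.one_le_exp hrp.le)
  · have hM1 : 0 < Real.log (maxMod f ‖z‖) := Real.log_pos hM
    rw [← Real.log_le_iff_le_exp (by linarith)]
    rw [← Real.log_le_log_iff hM1 hrp, Real.log_rpow (by linarith)]
    exact h3.le

theorem order_nonneg_or_const {f : ℂ → ℂ} (hf : Differentiable ℂ f) {ρ : ℝ}
    (hord : entireOrder f = (ρ : EReal)) : 0 ≤ ρ ∨ ∃ c, ∀ z, f z = c := by
  rcases le_or_gt 0 ρ with h | h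
  · exact Or.inl h
  refine Or.inr ?_
  obtain ⟨R, hR1, hR⟩ := exists_norm_le_exp_rpow hf.continuous hord h
  refine ⟨f 0, fun z => ?_⟩
  obtain ⟨C, hC⟩ := (isCompact_closedBall (0 : ℂ) R).exists_bound_of_continuousOn
    hf.continuous.continuousOn
  refine hf.apply_eq_apply_of_bounded ?_ z 0
  refine isBounded_iff_forall_norm_le.2 ⟨max C (Real.exp 1), ?_⟩
  rintro _ ⟨w, rfl⟩
  rcases le_or_gt R ‖w‖ with hw | hw
  · refine le_max_of_le_right ?_
    simpa using hR w hw
  · exact le_max_of_le_left (hC w (by simpa using hw.le))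

/-- Uniform bound for the number of preimages in a disc of points that are not too small. -/
theorem exists_card_preimage_le {f : ℂ → ℂ} (hf : Differentiable ℂ f) {ρ κ : ℝ} (hρ : 0 ≤ ρ)
    (hord : entireOrder f = (ρ : EReal)) (hκ : ρ < κ) :
    ∃ R C : ℝ, 1 < R ∧ 0 < C ∧ ∀ r, R ≤ r → ∀ w : ℂ, 2 * ‖f 0‖ + 1 ≤ ‖w‖ →
      ∀ T : Finset ℂ, (∀ z ∈ T, ‖z‖ ≤ r ∧ f z = w) → (T.card : ℝ) ≤ C * r ^ κ := by
  obtain ⟨R, hR1, hR⟩ := exists_norm_le_exp_rpow hf.continuous hord hκ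
  have hκ0 : 0 < κ := hρ.trans_lt hκ
  refine ⟨R, (2 + 3 ^ κ) / Real.log 2, hR1, by positivity, fun r hr w hw T hT => ?_⟩
  have hr0 : 0 < r := by linarith
  have hw1 : 1 ≤ ‖w‖ := le_trans (by linarith [norm_nonneg (f 0)]) hw
  have hrk : 1 ≤ r ^ κ := Real.one_le_rpow (by linarith) hκ0.le
  have h1 := two_pow_card_zeros_mul_norm_le hr0 (M := Real.exp ((3 * r) ^ κ) + ‖w‖) T
    (fun z => f z - w) (hf.sub_const w) (by
      intro z hz
      refine (norm_sub_le _ _).trans ?_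
      have := hR z (by rw [hz]; linarith)
      rw [hz] at this
      linarith) (by
      intro z hz
      exact ⟨(hT z hz).1, by rw [(hT z hz).2, sub_self]⟩)
  have h2 : ‖w‖ / 2 ≤ ‖f 0 - w‖ := by
    have := norm_sub_norm_le w (f 0)
    rw [norm_sub_rev] at this
    linarith
  have hexp : 1 ≤ Real.exp ((3 * r) ^ κ) := Real.one_le_exp (by positivity)
  have h3 : (2 : ℝ) ^ T.card * (‖w‖ / 2) ≤ 2 * Real.exp ((3 * r) ^ κ) * ‖w‖ := by
    calc (2 : ℝ) ^ T.card * (‖w‖ / 2) ≤ 2 ^ T.card * ‖f 0 - w‖ := by gcongr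
      _ ≤ _ := h1
      _ ≤ _ := by nlinarith
  have h4 : (2 : ℝ) ^ T.card ≤ 2 ^ 2 * Real.exp ((3 * r) ^ κ) := by
    have : (2 : ℝ) ^ T.card * ‖w‖ ≤ 2 ^ 2 * Real.exp ((3 * r) ^ κ) * ‖w‖ := by linarith
    exact le_of_mul_le_mul_right this (by linarith)
  have h5 := Real.log_le_log (by positivity) h4
  rw [Real.log_mul (by norm_num) (Real.exp_ne_zero _), Real.log_exp, Real.log_pow,
    Real.log_pow, Real.mul_rpow (by norm_num) hr0.le] at h5
  rw [div_mul_eq_mul_div, le_div_iff₀ (Real.log_pos (by norm_num))]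
  have h6 : Real.log 2 ≤ 1 := by linarith [Real.log_two_lt_d9]
  push_cast at h5
  nlinarith

theorem exists_measurable_injOn_partition {f : ℂ → ℂ} (hf : Differentiable ℂ f) :
    ∃ P : ℕ → Set ℂ, (∀ i, MeasurableSet (P i)) ∧ Pairwise (Function.onFun Disjoint P) ∧
      (∀ i, InjOn f (P i)) ∧ {z | deriv f z ≠ 0} ⊆ ⋃ i, P i := by
  have h1 : ∀ z : ℂ, ∃ U : Set ℂ, IsOpen U ∧ InjOn f U ∧ (deriv f z ≠ 0 → z ∈ U) := by
    intro z
    by_cases hz : deriv f z = 0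
    · exact ⟨∅, isOpen_empty, injOn_empty _, fun h => absurd hz h⟩
    · have h2 : HasStrictDerivAt f (deriv f z) z := hf.contDiff.contDiffAt.hasStrictDerivAt (n := 1)
        one_ne_zero
      have h3 := h2.hasStrictFDerivAt_equiv hz
      exact ⟨(h3.toOpenPartialHomeomorph f).source, (h3.toOpenPartialHomeomorph f).open_source,
        (h3.toOpenPartialHomeomorph f).injOn, fun _ => h3.mem_toOpenPartialHomeomorph_source⟩
  choose U hUo hUi hUm using h1
  obtain ⟨t, -, htc, hts⟩ := TopologicalSpace.countable_cover_nhdsWithin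
    (s := {z | deriv f z ≠ 0}) (f := U)
    fun z hz => mem_nhdsWithin_of_mem_nhds ((hUo z).mem_nhds (hUm z hz))
  rcases t.eq_empty_or_nonempty with rfl | htn
  · refine ⟨fun _ => ∅, fun _ => MeasurableSet.empty, fun i j _ => by simp [Function.onFun],
      fun _ => injOn_empty _, ?_⟩
    simpa using hts
  obtain ⟨e, rfl⟩ := htc.exists_eq_range htn
  refine ⟨disjointed fun n => U (e n), fun i => .disjointed (fun n => (hUo _).measurableSet) i,
    disjoint_disjointed _, fun i => (hUi _).mono (disjointed_subset _ i), ?_⟩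
  rw [iUnion_disjointed]
  simpa using hts

theorem abs_det_fderiv_restrictScalars {f : ℂ → ℂ} {z : ℂ} :
    |((ContinuousLinearMap.toSpanSingleton ℂ (deriv f z)).restrictScalars ℝ :
      ℂ →L[ℝ] ℂ).det| = ‖deriv f z‖ ^ 2 := by
  rw [ContinuousLinearMap.det]
  simp [LinearMap.det_restrictScalars, Algebra.norm_complex_eq, Complex.normSq_eq_norm_sq]

/-- Bound for the logarithmic area of a preimage in terms of the multiplicity and of the
logarithmic derivative. -/
theorem logMeasure_inter_preimage_le {f : ℂ → ℂ} (hf : Differentiable ℂ f) {S A : Set ℂ}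
    (hS : MeasurableSet S) (hA : MeasurableSet A) {c N : ℝ} (hc : 0 < c)
    (hSc : ∀ z ∈ S, z ≠ 0 ∧ c ≤ ‖z * deriv f z / f z‖)
    (hN : ∀ w ∈ A, ∀ T : Finset ℂ, (∀ z ∈ T, z ∈ S ∧ f z = w) → (T.card : ℝ) ≤ N) :
    logMeasure (S ∩ f ⁻¹' A) ≤ ENNReal.ofReal (N / c ^ 2) * logMeasure A := by
  obtain ⟨P, hPm, hPd, hPi, hPc⟩ := exists_measurable_injOn_partition hf
  set Q : ℕ → Set ℂ := fun i => (S ∩ f ⁻¹' A) ∩ P i with hQ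
  set g : ℂ → ℝ≥0∞ := fun z => ENNReal.ofReal ((‖z‖ ^ 2)⁻¹) with hg
  have hgm : Measurable g := by fun_prop
  have hQm : ∀ i, MeasurableSet (Q i) := fun i =>
    (hS.inter (hf.continuous.measurable hA)).inter (hPm i)
  have hQi : ∀ i, InjOn f (Q i) := fun i => (hPi i).mono inter_subset_right
  have hQA : ∀ i, f '' Q i ⊆ A := by
    rintro i _ ⟨z, hz, rfl⟩
    exact hz.1.2
  have himm : ∀ i, MeasurableSet (f '' Q i) := fun i =>
    (hQm i).image_of_continuousOn_injOn hf.continuous.continuousOn (hQi i)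
  have hcover : S ∩ f ⁻¹' A ⊆ ⋃ i, Q i := by
    intro z hz
    have hz' : deriv f z ≠ 0 := by
      intro h0
      have := (hSc z hz.1).2
      simp [h0] at this
      linarith
    obtain ⟨i, hi⟩ := mem_iUnion.1 (hPc hz')
    exact mem_iUnion.2 ⟨i, hz, hi⟩
  have hpiece : ∀ i, logMeasure (Q i) ≤
      ENNReal.ofReal ((c ^ 2)⁻¹) * ∫⁻ w in A, (f '' Q i).indicator g w := by
    intro i
    rw [setLIntegral_indicator (himm i), inter_eq_left.2 (hQA i),
      lintegral_image_eq_lintegral_abs_det_fderiv_mul volume (hQm i)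
        (f' := fun z => (ContinuousLinearMap.toSpanSingleton ℂ (deriv f z)).restrictScalars ℝ)
        (fun z _ => ((hf z).hasDerivAt.hasFDerivAt.restrictScalars ℝ).hasFDerivWithinAt) (hQi i),
      ← lintegral_const_mul' _ _ ENNReal.ofReal_ne_top, logMeasure_apply, logArea]
    refine setLIntegral_mono' (hQm i) fun z hz => ?_
    rw [abs_det_fderiv_restrictScalars, hg, ← ENNReal.ofReal_mul (by positivity),
      ← ENNReal.ofReal_mul (by positivity)]
    refine ENNReal.ofReal_le_ofReal ?_
    obtain ⟨hz0, hzc⟩ := hSc z hz.1.1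
    have hz0' : 0 < ‖z‖ := norm_pos_iff.2 hz0
    have h1 : c ^ 2 ≤ ‖z * deriv f z / f z‖ ^ 2 := by gcongr
    have hcp : 0 < c ^ 2 := by positivity
    rw [norm_div, norm_mul, div_pow, mul_pow] at h1
    rw [inv_mul_eq_div, le_div_iff₀ hcp, inv_mul_eq_div, div_le_iff₀ (by positivity)]
    calc c ^ 2 ≤ ‖z‖ ^ 2 * ‖deriv f z‖ ^ 2 / ‖f z‖ ^ 2 := h1
      _ = _ := by ring
  have hpt : ∀ w ∈ A, ∑' i, (f '' Q i).indicator g w ≤ ENNReal.ofReal N * g w := by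
    intro w hw
    rw [ENNReal.tsum_eq_iSup_sum]
    refine iSup_le fun s => ?_
    classical
    simp only [indicator_apply]
    rw [← Finset.sum_filter, Finset.sum_const, nsmul_eq_mul]
    gcongr
    have hex : ∀ i, ∃ z, w ∈ f '' Q i → z ∈ Q i ∧ f z = w := by
      intro i
      by_cases h : w ∈ f '' Q i
      · obtain ⟨z, hz⟩ := h
        exact ⟨z, fun _ => hz⟩
      · exact ⟨0, fun h' => absurd h' h⟩
    choose ζ hζ using hex
    have hcard := hN w hw ((s.filter fun i => w ∈ f '' Q i).image ζ) (by
      intro z hz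
      obtain ⟨i, hi, rfl⟩ := Finset.mem_image.1 hz
      have := hζ i (Finset.mem_filter.1 hi).2
      exact ⟨this.1.1.1, this.2⟩)
    rw [Finset.card_image_of_injOn] at hcard
    · rw [← ENNReal.ofReal_natCast]
      exact ENNReal.ofReal_le_ofReal hcard
    · intro i hi j hj hij
      by_contra hne
      have h1 := (hζ i (Finset.mem_filter.1 hi).2).1.2
      have h2 := (hζ j (Finset.mem_filter.1 hj).2).1.2
      have hij' : ζ i = ζ j := hij
      rw [← hij'] at h2
      exact Set.disjoint_left.1 (hPd hne) h1 h2
  calc logMeasure (S ∩ f ⁻¹' A) ≤ ∑' i, logMeasure (Q i) :=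
        (measure_mono hcover).trans (measure_iUnion_le _)
    _ ≤ ∑' i, ENNReal.ofReal ((c ^ 2)⁻¹) * ∫⁻ w in A, (f '' Q i).indicator g w :=
        ENNReal.tsum_le_tsum hpiece
    _ = ENNReal.ofReal ((c ^ 2)⁻¹) * ∫⁻ w in A, ∑' i, (f '' Q i).indicator g w := by
        rw [ENNReal.tsum_mul_left, lintegral_tsum]
        exact fun i => (hgm.indicator (himm i)).aemeasurable
    _ ≤ ENNReal.ofReal ((c ^ 2)⁻¹) * ∫⁻ w in A, ENNReal.ofReal N * g w := by
        gcongr 1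
        exact setLIntegral_mono' hA hpt
    _ = ENNReal.ofReal (N / c ^ 2) * logMeasure A := by
        rw [lintegral_const_mul _ hgm, ← mul_assoc, ← ENNReal.ofReal_mul (by positivity),
          inv_mul_eq_div, logMeasure_apply, logArea]

/-- The complement in `Δ` of the exceptional set. -/
def goodSet (f : ℂ → ℂ) (σ ε : ℝ) : Set ℂ :=
  {z | ‖z‖ ^ σ ≤ ‖z * deriv f z / f z‖ ∧ (1 + ε) * ‖z‖ ≤ ‖f z‖}

theorem measurableSet_goodSet {f : ℂ → ℂ} (hf : Differentiable ℂ f) (σ ε : ℝ) :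
    MeasurableSet (goodSet f σ ε) := by
  have h1 := hf.continuous.measurable
  have h2 := measurable_deriv f
  have m1 : Measurable fun z : ℂ => ‖z‖ ^ σ := by fun_prop
  have m2 : Measurable fun z : ℂ => ‖z * deriv f z / f z‖ := by fun_prop
  have m3 : Measurable fun z : ℂ => (1 + ε) * ‖z‖ := by fun_prop
  have m4 : Measurable fun z : ℂ => ‖f z‖ := by fun_prop
  exact (measurableSet_le m1 m2).inter (measurableSet_le m3 m4)

/-- Pulling back along the good set halves the logarithmic area. -/
theorem exists_logMeasure_preimage_le_half {f : ℂ → ℂ} (hf : Differentiable ℂ f) {ρ ε : ℝ}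
    (hρ : 0 ≤ ρ) (hε : 0 < ε) (hord : entireOrder f = (ρ : EReal)) :
    ∃ R : ℝ, 1 < R ∧ ∀ A : Set ℂ, MeasurableSet A → (∀ w ∈ A, R ≤ ‖w‖) →
      logMeasure ({z | R ≤ ‖z‖} ∩ goodSet f (ρ / 2 + ε) ε ∩ f ⁻¹' A) ≤ 2⁻¹ * logMeasure A := by
  obtain ⟨R₀, C, hR₀, hC, hcount⟩ := exists_card_preimage_le hf hρ hord
    (show ρ < ρ + ε by linarith)
  set C' : ℝ := C * 2 ^ (ρ + ε) with hC'
  have hC'0 : 0 < C' := by positivity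
  set q : ℝ := (2 : ℝ) ^ (-ε) with hq
  have hq0 : 0 < q := by positivity
  have hq1 : q < 1 := Real.rpow_lt_one_of_one_lt_of_neg (by norm_num) (by linarith)
  have htend : Tendsto (fun R : ℝ => C' * R ^ (-ε) * (1 - q)⁻¹) atTop (𝓝 0) := by
    have := ((tendsto_rpow_neg_atTop hε).const_mul C').mul_const (1 - q)⁻¹
    simpa using this
  obtain ⟨R, hRsmall, hRR₀, hRf⟩ := ((htend.eventually_le_const
    (show (0 : ℝ) < 1 / 2 by norm_num)).and ((eventually_ge_atTop R₀).and
      (eventually_ge_atTop (2 * ‖f 0‖ + 1)))).exists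
  have hR1 : 1 < R := hR₀.trans_le hRR₀
  have hR0 : 0 < R := by linarith
  refine ⟨R, hR1, fun A hA hAR => ?_⟩
  set S : ℕ → Set ℂ := fun k =>
    {z | R * 2 ^ k ≤ ‖z‖ ∧ ‖z‖ ≤ R * 2 ^ (k + 1)} ∩ goodSet f (ρ / 2 + ε) ε with hS
  have hSm : ∀ k, MeasurableSet (S k) := fun k =>
    ((measurableSet_le measurable_const measurable_norm).inter
      (measurableSet_le measurable_norm measurable_const)).inter (measurableSet_goodSet hf _ _)
  have hcover : {z | R ≤ ‖z‖} ∩ goodSet f (ρ / 2 + ε) ε ∩ f ⁻¹' A ⊆ ⋃ k, S k ∩ f ⁻¹' A := by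
    rintro z ⟨⟨hzR, hzg⟩, hzA⟩
    have hzR' : R ≤ ‖z‖ := hzR
    obtain ⟨k, hk1, hk2⟩ := exists_nat_pow_near (x := ‖z‖ / R) (y := (2 : ℝ))
      (by rwa [le_div_iff₀ hR0, one_mul]) (by norm_num)
    rw [le_div_iff₀ hR0] at hk1
    rw [div_lt_iff₀ hR0] at hk2
    exact mem_iUnion.2 ⟨k, ⟨⟨by rw [mul_comm]; exact hk1, by rw [mul_comm]; exact hk2.le⟩, hzg⟩, hzA⟩
  have hterm : ∀ k, logMeasure (S k ∩ f ⁻¹' A) ≤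
      ENNReal.ofReal (C' * R ^ (-ε) * q ^ k) * logMeasure A := by
    intro k
    have hpk : (0 : ℝ) < R * 2 ^ k := by positivity
    have hrk : 1 ≤ (2 : ℝ) ^ k := one_le_pow₀ (by norm_num)
    have hσ : 0 ≤ ρ / 2 + ε := by linarith
    refine (logMeasure_inter_preimage_le hf (hSm k) hA (c := (R * 2 ^ k) ^ (ρ / 2 + ε))
      (N := C * (R * 2 ^ (k + 1)) ^ (ρ + ε)) (by positivity) ?_ ?_).trans (le_of_eq ?_)
    · rintro z ⟨⟨hz1, hz2⟩, hzg⟩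
      refine ⟨norm_pos_iff.1 (hpk.trans_le hz1), le_trans ?_ hzg.1⟩
      exact Real.rpow_le_rpow hpk.le hz1 hσ
    · intro w hw T hT
      refine hcount _ ?_ w (hRf.trans (hAR w hw)) T fun z hz => ⟨(hT z hz).1.1.2, (hT z hz).2⟩
      have : 1 ≤ (2 : ℝ) ^ (k + 1) := one_le_pow₀ (by norm_num)
      nlinarith
    · congr 2
      have e1 : (R * 2 ^ (k + 1)) ^ (ρ + ε) = (R * 2 ^ k) ^ (ρ + ε) * 2 ^ (ρ + ε) := by
        rw [pow_succ, ← mul_assoc, Real.mul_rpow hpk.le (by norm_num)]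
      have e2 : ((R * 2 ^ k) ^ (ρ / 2 + ε)) ^ 2 = (R * 2 ^ k) ^ (ρ + ε) * (R * 2 ^ k) ^ ε := by
        rw [← Real.rpow_natCast, ← Real.rpow_mul hpk.le, ← Real.rpow_add hpk]
        congr 1
        push_cast
        ring
      have e3 : q ^ k = ((2 : ℝ) ^ k) ^ (-ε) := by
        rw [hq, ← Real.rpow_natCast, ← Real.rpow_natCast, ← Real.rpow_mul (by norm_num),
          ← Real.rpow_mul (by norm_num), mul_comm]
      rw [e1, e2, e3, mul_assoc C', ← Real.mul_rpow hR0.le (by positivity), Real.rpow_neg hpk.le]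
      have := Real.rpow_pos_of_pos hpk (ρ + ε)
      have := Real.rpow_pos_of_pos hpk ε
      field_simp
      exact hC'.symm
  calc _ ≤ ∑' k, logMeasure (S k ∩ f ⁻¹' A) :=
        (measure_mono hcover).trans (measure_iUnion_le _)
    _ ≤ ∑' k, ENNReal.ofReal (C' * R ^ (-ε) * q ^ k) * logMeasure A := ENNReal.tsum_le_tsum hterm
    _ = ENNReal.ofReal (C' * R ^ (-ε) * (1 - q)⁻¹) * logMeasure A := by
        rw [ENNReal.tsum_mul_right, ← ENNReal.ofReal_tsum_of_nonneg (fun k => by positivity)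
          ((summable_geometric_of_lt_one hq0.le hq1).mul_left _), tsum_mul_left,
          tsum_geometric_of_lt_one hq0.le hq1]
    _ ≤ 2⁻¹ * logMeasure A := by
        gcongr
        refine (ENNReal.ofReal_le_ofReal hRsmall).trans (le_of_eq ?_)
        rw [one_div, ENNReal.ofReal_inv_of_pos (by norm_num)]
        simp

/-- The set of points all of whose iterates stay in the good set has a complement of finite
logarithmic area. -/
theorem exists_invariant_subset_goodSet {f : ℂ → ℂ} (hf : Differentiable ℂ f) {ρ ε : ℝ}
    (hρ : 0 ≤ ρ) (hε : 0 < ε) (hord : entireOrder f = (ρ : EReal))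
    (hyp : logMeasure (Delta \ goodSet f (ρ / 2 + ε) ε) < ⊤) :
    ∃ R : ℝ, 1 < R ∧ ∃ X : Set ℂ, (∀ z ∈ X, R ≤ ‖z‖) ∧ X ⊆ goodSet f (ρ / 2 + ε) ε ∧
      MapsTo f X X ∧ logMeasure (Delta \ X) < ⊤ := by
  obtain ⟨R, hR1, hR⟩ := exists_logMeasure_preimage_le_half hf hρ hε hord
  set G := goodSet f (ρ / 2 + ε) ε with hG
  have hGm : MeasurableSet G := measurableSet_goodSet hf _ _
  have hDm : MeasurableSet {z : ℂ | R ≤ ‖z‖} := measurableSet_le measurable_const measurable_norm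
  set B : ℕ → Set ℂ := fun n => Nat.rec ({z | R ≤ ‖z‖} \ G)
    (fun _ A => {z | R ≤ ‖z‖} ∩ G ∩ f ⁻¹' A) n with hB
  have hB0 : B 0 = {z | R ≤ ‖z‖} \ G := rfl
  have hBs : ∀ n, B (n + 1) = {z | R ≤ ‖z‖} ∩ G ∩ f ⁻¹' B n := fun n => rfl
  have hBm : ∀ n, MeasurableSet (B n) := by
    intro n
    induction n with
    | zero => exact hDm.diff hGm
    | succ n ih => exact (hDm.inter hGm).inter (hf.continuous.measurable ih)
  have hBR : ∀ n, ∀ z ∈ B n, R ≤ ‖z‖ := by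
    intro n z hz
    cases n with
    | zero => exact hz.1
    | succ n => exact hz.1.1
  have hBle : ∀ n, logMeasure (B n) ≤ 2⁻¹ ^ n * logMeasure (Delta \ G) := by
    intro n
    induction n with
    | zero =>
      rw [pow_zero, one_mul]
      exact measure_mono fun z hz => ⟨hR1.le.trans hz.1, hz.2⟩
    | succ n ih =>
      rw [hBs, pow_succ', mul_assoc]
      exact (hR _ (hBm n) (hBR n)).trans (by gcongr)
  refine ⟨R, hR1, {z | R ≤ ‖z‖} \ ⋃ n, B n, fun z hz => hz.1, ?_, ?_, ?_⟩
  · intro z hz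
    by_contra h
    exact hz.2 (mem_iUnion.2 ⟨0, hz.1, h⟩)
  · intro z hz
    have hzG : z ∈ G := by
      by_contra h
      exact hz.2 (mem_iUnion.2 ⟨0, hz.1, h⟩)
    have hzR : R ≤ ‖z‖ := hz.1
    refine ⟨?_, fun h => ?_⟩
    · have := hzG.2
      change R ≤ ‖f z‖
      nlinarith
    · obtain ⟨n, hn⟩ := mem_iUnion.1 h
      exact hz.2 (mem_iUnion.2 ⟨n + 1, ⟨hz.1, hzG⟩, hn⟩)
  · have hsub : Delta \ ({z | R ≤ ‖z‖} \ ⋃ n, B n) ⊆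
        {z : ℂ | 1 ≤ ‖z‖ ∧ ‖z‖ < R} ∪ ⋃ n, B n := by
      rintro z ⟨hz1, hz2⟩
      by_cases h : R ≤ ‖z‖
      · right
        by_contra h'
        exact hz2 ⟨h, h'⟩
      · exact Or.inl ⟨hz1, not_le.1 h⟩
    refine (measure_mono hsub).trans_lt ((measure_union_le _ _).trans_lt
      (ENNReal.add_lt_top.2 ⟨logMeasure_bounded_annulus_lt_top R, ?_⟩))
    calc logMeasure (⋃ n, B n) ≤ ∑' n, 2⁻¹ ^ n * logMeasure (Delta \ G) :=
          (measure_iUnion_le _).trans (ENNReal.tsum_le_tsum hBle)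
      _ = 2 * logMeasure (Delta \ G) := by
          rw [ENNReal.tsum_mul_right, ENNReal.tsum_geometric, ENNReal.one_sub_inv_two, inv_inv]
      _ < ⊤ := ENNReal.mul_lt_top (by simp) hyp

theorem exists_differentiableOn_log {U : Set ℂ} (hUc : IsSimplyConnected U) (hU : IsOpen U)
    {g : ℂ → ℂ} (hg : DifferentiableOn ℂ g U) (h0 : ∀ z ∈ U, g z ≠ 0) :
    ∃ L : ℂ → ℂ, DifferentiableOn ℂ L U ∧ ∀ z ∈ U, Complex.exp (L z) = g z := by
  obtain ⟨L, hLc, hL⟩ := Complex.exists_continuousOn_eqOn_exp_comp hUc hU hg.continuousOn (by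
    rintro ⟨z, hz, h⟩
    exact h0 z hz h)
  exact ⟨L, fun z hz => (hasDerivAt_of_exp_eq hU hLc hL hz
    (hg.differentiableAt (hU.mem_nhds hz)).hasDerivAt).differentiableAt.differentiableWithinAt, hL⟩

theorem isSimplyConnected_of_convex {U : Set ℂ} (hU : Convex ℝ U) (hne : U.Nonempty) :
    IsSimplyConnected U := by
  have := hU.contractibleSpace hne
  exact inferInstanceAs (SimplyConnectedSpace U)

/-- An entire function of polynomial growth is constant or behaves like a monomial. -/
theorem tendsto_div_pow_of_polynomial_growth (K : ℕ) : ∀ {q : ℂ → ℂ}, Differentiable ℂ q →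
    ∀ {C : ℝ}, (∀ z, ‖q z‖ ≤ C * (1 + ‖z‖) ^ K) → (∃ c, ∀ z, q z = c) ∨
      ∃ d : ℕ, 1 ≤ d ∧ ∃ c : ℂ, c ≠ 0 ∧
        Tendsto (fun z => q z / z ^ d) (Bornology.cobounded ℂ) (𝓝 c) := by
  induction K with
  | zero =>
    intro q hq C hC
    left
    refine ⟨q 0, fun z => hq.apply_eq_apply_of_bounded ?_ z 0⟩
    refine (isBounded_iff_forall_norm_le).2 ⟨C, ?_⟩
    rintro _ ⟨w, rfl⟩
    simpa using hC w
  | succ K ih =>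
    intro q hq C hC
    set p := dslope q 0 with hp
    have hpd : Differentiable ℂ p := by
      rw [← differentiableOn_univ] at hq ⊢
      exact (Complex.differentiableOn_dslope univ_mem).2 hq
    have hpq : ∀ z, q z = q 0 + z * p z := by
      intro z
      have := sub_smul_dslope q 0 z
      simp only [sub_zero, smul_eq_mul] at this
      rw [hp, this]
      ring
    obtain ⟨B, hB⟩ := (isCompact_closedBall (0 : ℂ) 1).exists_bound_of_continuousOn
      hpd.continuous.continuousOn
    have hB0 : 0 ≤ B := (norm_nonneg _).trans (hB 0 (by simp))
    have hC0 : 0 ≤ C := by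
      have := (norm_nonneg _).trans (hC 0)
      simpa using this
    have hbound : ∀ z, ‖p z‖ ≤ (B + 2 * C + ‖q 0‖) * (1 + ‖z‖) ^ K := by
      intro z
      have h1 : 1 ≤ (1 + ‖z‖) ^ K := one_le_pow₀ (by linarith [norm_nonneg z])
      rcases le_total ‖z‖ 1 with hz | hz
      · have := hB z (by simpa using hz)
        nlinarith [norm_nonneg (q 0)]
      · have h2 : ‖z‖ * ‖p z‖ ≤ C * (1 + ‖z‖) ^ (K + 1) + ‖q 0‖ := by
          rw [← norm_mul, show z * p z = q z - q 0 by rw [hpq z]; ring]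
          exact (norm_sub_le _ _).trans (by gcongr; exact hC z)
        have h3 : C * (1 + ‖z‖) ^ (K + 1) ≤ ‖z‖ * (2 * C * (1 + ‖z‖) ^ K) := by
          rw [pow_succ]
          have : 0 ≤ C * (1 + ‖z‖) ^ K := by positivity
          nlinarith
        have h4 : ‖q 0‖ ≤ ‖z‖ * (‖q 0‖ * (1 + ‖z‖) ^ K) := by
          have : ‖q 0‖ ≤ ‖q 0‖ * (1 + ‖z‖) ^ K := le_mul_of_one_le_right (norm_nonneg _) h1
          nlinarith [norm_nonneg (q 0)]
        have h5 : ‖z‖ * ‖p z‖ ≤ ‖z‖ * ((2 * C + ‖q 0‖) * (1 + ‖z‖) ^ K) := by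
          nlinarith
        have h6 := le_of_mul_le_mul_left h5 (by linarith)
        nlinarith
    rcases ih hpd hbound with ⟨c, hc⟩ | ⟨d, hd, c, hc0, hc⟩
    · by_cases hc0 : c = 0
      · left
        refine ⟨q 0, fun z => ?_⟩
        rw [hpq z, hc z, hc0, mul_zero, add_zero]
      · right
        refine ⟨1, le_rfl, c, hc0, ?_⟩
        have h1 : Tendsto (fun z : ℂ => q 0 * z⁻¹ + c) (Bornology.cobounded ℂ) (𝓝 c) := by
          simpa using (tendsto_inv₀_cobounded (α := ℂ)).const_mul (q 0) |>.add_const c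
        refine h1.congr' ?_
        filter_upwards [Bornology.eventually_ne_cobounded (0 : ℂ)] with z hz
        rw [hpq z, hc z]
        field_simp
    · right
      refine ⟨d + 1, by omega, c, hc0, ?_⟩
      have h0 : Tendsto (fun z : ℂ => (z⁻¹) ^ (d + 1)) (Bornology.cobounded ℂ) (𝓝 0) := by
        simpa using (tendsto_inv₀_cobounded (α := ℂ)).pow (d + 1)
      have h1 := (h0.const_mul (q 0)).add hc
      rw [mul_zero, zero_add] at h1
      refine h1.congr' ?_
      filter_upwards [Bornology.eventually_ne_cobounded (0 : ℂ)] with z hz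
      rw [hpq z, inv_pow]
      field_simp
      ring

/-- A zero-free entire function of finite order is constant or at most `1` on a cone. -/
theorem const_or_norm_le_one_on_cone {g : ℂ → ℂ} (hg : Differentiable ℂ g) (h0 : ∀ z, g z ≠ 0)
    {K : ℕ} {R : ℝ} (hR : 1 < R) (hgr : ∀ z, R ≤ ‖z‖ → ‖g z‖ ≤ Real.exp (1 + ‖z‖ ^ K)) :
    (∃ c, ∀ z, g z = c) ∨ ∃ z₁ : ℂ, ∃ δ T : ℝ, z₁ ≠ 0 ∧ 0 < δ ∧
      ∀ t : ℝ, T ≤ t → ∀ ζ ∈ ball z₁ δ, ‖g ((t : ℂ) * ζ)‖ ≤ 1 := by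
  obtain ⟨q, hqd, hq⟩ := exists_differentiableOn_log
    (isSimplyConnected_of_convex convex_univ univ_nonempty) isOpen_univ hg.differentiableOn
    fun z _ => h0 z
  rw [differentiableOn_univ] at hqd
  have hre : ∀ z, ‖g z‖ = Real.exp (q z).re := fun z => by rw [← hq z trivial, Complex.norm_exp]
  obtain ⟨B, hB⟩ := (isCompact_closedBall (0 : ℂ) R).exists_bound_of_continuousOn
    hqd.continuous.continuousOn
  have hB0 : 0 ≤ B := (norm_nonneg _).trans (hB 0 (by simp; linarith))
  have hM : ∀ z, (q z).re ≤ (B + 2) * (1 + ‖z‖) ^ K := by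
    intro z
    have h1 : 1 ≤ (1 + ‖z‖) ^ K := one_le_pow₀ (by linarith [norm_nonneg z])
    rcases le_total ‖z‖ R with hz | hz
    · have := hB z (by simpa using hz)
      have := Complex.re_le_norm (q z)
      nlinarith
    · have h2 := hgr z hz
      rw [hre, Real.exp_le_exp] at h2
      have h3 : ‖z‖ ^ K ≤ (1 + ‖z‖) ^ K := by gcongr; linarith
      nlinarith
  have hbound : ∀ z, ‖q z‖ ≤ (2 * ((B + 2) * 3 ^ K) + 3 * ‖q 0‖) * (1 + ‖z‖) ^ K := by
    intro z
    have hz := norm_nonneg z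
    have h1 : 1 ≤ (1 + ‖z‖) ^ K := one_le_pow₀ (by linarith)
    set M : ℝ := (B + 2) * (3 * (1 + ‖z‖)) ^ K with hMdef
    have hMpos : 0 < M := by positivity
    have h2 := Complex.borelCaratheodory (f := q) (R := 2 * (1 + ‖z‖)) (z := z) hMpos
      hqd.differentiableOn (by
        intro w hw
        refine (hM w).trans ?_
        have : ‖w‖ < 2 * (1 + ‖z‖) := by simpa using hw
        rw [hMdef]
        gcongr
        linarith) (by positivity) (by simp; linarith)
    have h3 : 2 * M * ‖z‖ / (2 * (1 + ‖z‖) - ‖z‖) ≤ 2 * M := by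
      rw [div_le_iff₀ (by linarith)]
      nlinarith
    have h4 : ‖q 0‖ * (2 * (1 + ‖z‖) + ‖z‖) / (2 * (1 + ‖z‖) - ‖z‖) ≤ 3 * ‖q 0‖ := by
      rw [div_le_iff₀ (by linarith)]
      nlinarith [norm_nonneg (q 0)]
    calc ‖q z‖ ≤ 2 * M + 3 * ‖q 0‖ := by linarith
      _ ≤ 2 * M + 3 * ‖q 0‖ * (1 + ‖z‖) ^ K := by
        have := le_mul_of_one_le_right (by positivity : 0 ≤ 3 * ‖q 0‖) h1
        linarith
      _ = _ := by rw [hMdef, mul_pow]; ring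
  rcases tendsto_div_pow_of_polynomial_growth K hqd hbound with ⟨c, hc⟩ | ⟨d, hd, c, hc0, hc⟩
  · exact Or.inl ⟨Complex.exp c, fun z => by rw [← hq z trivial, hc]⟩
  right
  obtain ⟨z₁, hz₁⟩ := IsAlgClosed.exists_pow_nat_eq (-c⁻¹) (by omega : 0 < d)
  have hz₁0 : z₁ ≠ 0 := by
    rintro rfl
    rw [zero_pow (by omega)] at hz₁
    exact neg_ne_zero.2 (inv_ne_zero hc0) hz₁.symm
  have hcont : ContinuousAt (fun ζ : ℂ => c * ζ ^ d) z₁ := by fun_prop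
  have hval : c * z₁ ^ d = -1 := by rw [hz₁]; field_simp
  obtain ⟨δ₁, hδ₁, hball⟩ := Metric.continuousAt_iff.1 hcont (1 / 4) (by norm_num)
  have hc0' : 0 < ‖c‖ := norm_pos_iff.2 hc0
  have hz₁p : 0 < ‖z₁‖ := norm_pos_iff.2 hz₁0
  have hev := (Metric.tendsto_nhds.1 hc) (‖c‖ / 4) (by positivity)
  rw [← comap_norm_atTop, eventually_comap] at hev
  obtain ⟨T, hT⟩ := eventually_atTop.1 hev
  refine ⟨z₁, min δ₁ (‖z₁‖ / 2), max 1 (T * (2 / ‖z₁‖)), hz₁0, lt_min hδ₁ (by positivity), ?_⟩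
  intro t ht ζ hζ
  have ht1 : 1 ≤ t := (le_max_left _ _).trans ht
  have htT : T * (2 / ‖z₁‖) ≤ t := (le_max_right _ _).trans ht
  rw [mem_ball] at hζ
  have hζ1 := hball (hζ.trans_le (min_le_left _ _))
  rw [hval, dist_eq_norm, sub_neg_eq_add] at hζ1
  have hζ2 : ‖z₁‖ / 2 < ‖ζ‖ := by
    have h1 := hζ.trans_le (min_le_right _ _)
    rw [dist_eq_norm] at h1
    have h2 := norm_sub_norm_le z₁ ζ
    rw [norm_sub_rev] at h2
    linarith
  have hζ0 : ζ ≠ 0 := norm_pos_iff.1 (by linarith)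
  have htζ : T ≤ ‖(t : ℂ) * ζ‖ := by
    rw [norm_mul, Complex.norm_real, Real.norm_eq_abs, abs_of_pos (by linarith)]
    rw [mul_div_assoc', div_le_iff₀ hz₁p] at htT
    nlinarith
  have hq1 := hT _ htζ _ rfl
  set w : ℂ := (t : ℂ) * ζ with hw
  have hw0 : w ≠ 0 := mul_ne_zero (by exact_mod_cast (by linarith : t ≠ 0)) hζ0
  set e : ℂ := q w / w ^ d - c with he
  rw [dist_eq_norm, ← he] at hq1
  have hqw : q w = ((t ^ d : ℝ) : ℂ) * (c * ζ ^ d + e * ζ ^ d) := by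
    have : q w = w ^ d * (c + e) := by
      rw [he]
      field_simp
      ring
    rw [this, hw]
    push_cast
    ring
  have h5 : ‖c‖ * ‖ζ ^ d‖ ≤ 5 / 4 := by
    rw [← norm_mul]
    have := norm_sub_norm_le (c * ζ ^ d) (-1)
    rw [sub_neg_eq_add, norm_neg, norm_one] at this
    linarith
  have h6 : ‖e * ζ ^ d‖ ≤ 5 / 16 := by
    rw [norm_mul]
    have := mul_le_mul_of_nonneg_right hq1.le (norm_nonneg (ζ ^ d))
    linarith
  have h7 := Complex.re_le_norm (e * ζ ^ d)
  have h8 := Complex.re_le_norm (c * ζ ^ d + 1)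
  rw [Complex.add_re, Complex.one_re] at h8
  rw [hre, Real.exp_le_one_iff, hqw, Complex.re_ofReal_mul, Complex.add_re]
  exact mul_nonpos_of_nonneg_of_nonpos (by positivity) (by linarith)

theorem exists_fixed_point {f : ℂ → ℂ} (hf : Differentiable ℂ f) {ρ ε σ : ℝ} (hε : 0 < ε)
    (hord : entireOrder f = (ρ : EReal)) (hyp : logMeasure (Delta \ goodSet f σ ε) < ⊤) :
    ∃ p, f p = p := by
  by_contra! hfix
  obtain ⟨K, hK⟩ := exists_nat_gt (max ρ 1)
  have hKρ : ρ < K := (le_max_left _ _).trans_lt hK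
  have hK1 : (1 : ℝ) < K := (le_max_right _ _).trans_lt hK
  obtain ⟨R, hR1, hR⟩ := exists_norm_le_exp_rpow hf.continuous hord hKρ
  have hgr : ∀ z, R ≤ ‖z‖ → ‖f z - z‖ ≤ Real.exp (1 + ‖z‖ ^ K) := by
    intro z hz
    have h1 := hR z hz
    rw [Real.rpow_natCast] at h1
    have h2 : ‖z‖ ≤ ‖z‖ ^ K :=
      le_self_pow₀ (by linarith) (by rintro rfl; norm_num at hK1)
    have h3 := Real.add_one_le_exp (‖z‖ ^ K)
    have h4 := Real.add_one_le_exp 1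
    rw [Real.exp_add]
    have h5 := Real.exp_pos (‖z‖ ^ K)
    nlinarith [norm_sub_le (f z) z]
  rcases const_or_norm_le_one_on_cone (g := fun z => f z - z) (hf.sub differentiable_id)
    (fun z => sub_ne_zero.2 (hfix z)) hR1 hgr with ⟨c, hc⟩ | ⟨z₁, δ, T, hz₁, hδ, hcone⟩
  · refine hyp.ne (logMeasure_eq_top_of_norm_ge (R := max 1 ((‖c‖ + 1) / ε)) fun z hz => ?_)
    have hz1 : 1 ≤ ‖z‖ := (le_max_left _ _).trans hz
    have hz2 : (‖c‖ + 1) / ε ≤ ‖z‖ := (le_max_right _ _).trans hz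
    rw [div_le_iff₀ hε] at hz2
    refine ⟨hz1, fun hg => ?_⟩
    have h1 := hg.2
    have h2 : ‖f z‖ ≤ ‖c‖ + ‖z‖ := by
      rw [← sub_add_cancel (f z) z, hc z]
      exact norm_add_le _ _
    nlinarith
  · have hz₁p : 0 < ‖z₁‖ := norm_pos_iff.2 hz₁
    refine hyp.ne (logMeasure_eq_top_of_cone (z₁ := z₁) (δ := min δ (‖z₁‖ / 2))
      (T := max (max T 1) ((1 + 2 / ε) * (2 / ‖z₁‖))) hz₁ (by positivity) fun t ht ζ hζ => ?_)
    have htT : T ≤ t := ((le_max_left _ _).trans (le_max_left _ _)).trans ht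
    have ht1 : 1 ≤ t := ((le_max_right _ _).trans (le_max_left _ _)).trans ht
    have ht2 := (le_max_right _ _).trans ht
    have h1 := hcone t htT ζ (ball_subset_ball (min_le_left _ _) hζ)
    have hζ2 : ‖z₁‖ / 2 < ‖ζ‖ := by
      have h1 := (mem_ball.1 hζ).trans_le (min_le_right _ _)
      rw [dist_eq_norm] at h1
      have h2 := norm_sub_norm_le z₁ ζ
      rw [norm_sub_rev] at h2
      linarith
    have hw : 1 + 2 / ε ≤ ‖(t : ℂ) * ζ‖ := by
      rw [norm_mul, Complex.norm_real, Real.norm_eq_abs, abs_of_pos (by linarith)]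
      rw [mul_div_assoc', div_le_iff₀ hz₁p] at ht2
      nlinarith
    set w : ℂ := (t : ℂ) * ζ
    have hε2 : 0 < 2 / ε := by positivity
    refine ⟨show 1 ≤ ‖w‖ by linarith, fun hg => ?_⟩
    have h2 := hg.2
    have h3 : ‖f w‖ ≤ 1 + ‖w‖ := by
      rw [← sub_add_cancel (f w) w]
      exact (norm_add_le _ _).trans (by gcongr)
    have h4 : 2 / ε * ε ≤ ‖w‖ * ε := by gcongr; linarith
    rw [div_mul_cancel₀ _ hε.ne'] at h4
    nlinarith

theorem subset_escapingSet {f : ℂ → ℂ} {X : Set ℂ} {R ε : ℝ} (hR : 1 < R) (hε : 0 < ε)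
    (hX : ∀ z ∈ X, R ≤ ‖z‖) (hXe : ∀ z ∈ X, (1 + ε) * ‖z‖ ≤ ‖f z‖) (hm : MapsTo f X X) :
    X ⊆ escapingSet f := by
  intro z hz
  have h1 : ∀ n, (1 + ε) ^ n ≤ ‖f^[n] z‖ := by
    intro n
    induction n with
    | zero => simpa using hR.le.trans (hX z hz)
    | succ n ih =>
      rw [Function.iterate_succ_apply', pow_succ']
      refine le_trans ?_ (hXe _ (hm.iterate n hz))
      gcongr
  exact tendsto_atTop_mono h1 (tendsto_pow_atTop_atTop_of_one_lt (by linarith))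

theorem logMeasure_Delta : logMeasure Delta = ⊤ :=
  logMeasure_eq_top_of_norm_ge fun _ h => h

theorem volume_pos_of_logMeasure_diff_lt_top {S : Set ℂ} (h : logMeasure (Delta \ S) < ⊤) :
    0 < volume S := by
  rw [pos_iff_ne_zero]
  intro h0
  have h1 : logMeasure S = 0 := withDensity_absolutelyContinuous _ _ h0
  have h2 : logMeasure Delta ≤ logMeasure (Delta \ S) + logMeasure S :=
    (measure_mono fun z hz => by
      by_cases hzS : z ∈ S
      · exact Or.inr hzS
      · exact Or.inl ⟨hz, hzS⟩).trans (measure_union_le _ _)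
  rw [h1, add_zero, logMeasure_Delta] at h2
  exact absurd h2 (not_le.2 h)

/-- Half the chordal distance from `w` to `∞`. -/
noncomputable def chordalHeight (w : ℂ) : ℝ := (Real.sqrt (1 + ‖w‖ ^ 2))⁻¹

theorem chordalHeight_pos (w : ℂ) : 0 < chordalHeight w := by
  unfold chordalHeight
  positivity

theorem continuous_chordalHeight : Continuous chordalHeight := by
  unfold chordalHeight
  exact Continuous.inv₀ (by fun_prop) fun w => by positivity

theorem exists_abs_chordalHeight_sub_le (x : Option ℂ) :
    ∃ v : ℝ, ∀ w : ℂ, |chordalHeight w - v| ≤ chordalDist (some w) x := by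
  cases x with
  | none =>
    refine ⟨0, fun w => ?_⟩
    rw [sub_zero, abs_of_pos (chordalHeight_pos w), chordalDist, chordalHeight, div_eq_mul_inv]
    have := chordalHeight_pos w
    rw [chordalHeight] at this
    linarith
  | some y =>
    refine ⟨chordalHeight y, fun w => ?_⟩
    rw [chordalDist, chordalHeight, chordalHeight]
    have hs : ∀ t : ℝ, 0 < 1 + t ^ 2 := fun t => by positivity
    set a := Real.sqrt (1 + ‖w‖ ^ 2) with ha
    set b := Real.sqrt (1 + ‖y‖ ^ 2) with hb
    have ha0 : 0 < a := Real.sqrt_pos.2 (hs _)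
    have hb0 : 0 < b := Real.sqrt_pos.2 (hs _)
    have ha2 : a ^ 2 = 1 + ‖w‖ ^ 2 := Real.sq_sqrt (hs _).le
    have hb2 : b ^ 2 = 1 + ‖y‖ ^ 2 := Real.sq_sqrt (hs _).le
    have haw : ‖w‖ ≤ a := Real.le_sqrt_of_sq_le (by linarith)
    have hby : ‖y‖ ≤ b := Real.le_sqrt_of_sq_le (by linarith)
    have h1 : |b - a| ≤ ‖w - y‖ := by
      have h2 : |b - a| * (a + b) ≤ ‖w - y‖ * (a + b) := by
        calc |b - a| * (a + b) = |b ^ 2 - a ^ 2| := by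
              rw [show b ^ 2 - a ^ 2 = (b - a) * (a + b) by ring, abs_mul,
                abs_of_pos (by positivity : 0 < a + b)]
          _ = |‖w‖ - ‖y‖| * (‖w‖ + ‖y‖) := by
              rw [ha2, hb2, abs_sub_comm, show 1 + ‖w‖ ^ 2 - (1 + ‖y‖ ^ 2) =
                (‖w‖ - ‖y‖) * (‖w‖ + ‖y‖) by ring, abs_mul,
                abs_of_nonneg (by positivity : 0 ≤ ‖w‖ + ‖y‖)]
          _ ≤ ‖w - y‖ * (a + b) := by
              gcongr
              exact abs_norm_sub_norm_le w y
      exact le_of_mul_le_mul_right h2 (by positivity)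
    rw [inv_sub_inv ha0.ne' hb0.ne', abs_div, abs_of_pos (mul_pos ha0 hb0)]
    gcongr
    linarith [norm_nonneg (w - y)]

theorem tendsto_chordalHeight {a : ℕ → ℂ} (h : Tendsto (fun n => ‖a n‖) atTop atTop) :
    Tendsto (fun n => chordalHeight (a n)) atTop (𝓝 0) := by
  refine tendsto_inv_atTop_zero.comp (tendsto_atTop_mono (fun n => ?_) h)
  exact Real.le_sqrt_of_sq_le (by linarith)

theorem chordalHeight_le_of_norm_le {w v : ℂ} (h : ‖w‖ ≤ ‖v‖) :
    chordalHeight v ≤ chordalHeight w := by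
  unfold chordalHeight
  gcongr

theorem exists_subseq_tendstoUniformlyOn_chordalHeight {f : ℂ → ℂ} (hf : Continuous f) {z : ℂ}
    (hz : z ∈ fatouSet f) : ∃ δ : ℝ, 0 < δ ∧ ∀ φ : ℕ → ℕ, StrictMono φ →
      ∃ ψ : ℕ → ℕ, StrictMono ψ ∧ ∃ v : ℂ → ℝ, ContinuousOn v (closedBall z δ) ∧
        TendstoUniformlyOn (fun n w => chordalHeight (f^[φ (ψ n)] w)) v atTop
          (closedBall z δ) := by
  obtain ⟨U, hU, hφ⟩ := hz
  obtain ⟨δ, hδ, hball⟩ := Metric.nhds_basis_closedBall.mem_iff.1 hU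
  refine ⟨δ, hδ, fun φ h => ?_⟩
  obtain ⟨ψ, hψ, g, hg⟩ := hφ φ h
  choose v hv using exists_abs_chordalHeight_sub_le
  have hunif : TendstoUniformlyOn (fun n w => chordalHeight (f^[φ (ψ n)] w)) (fun w => v (g w))
      atTop (closedBall z δ) := by
    rw [Metric.tendstoUniformlyOn_iff]
    intro η hη
    filter_upwards [hg _ hball (isCompact_closedBall _ _) η hη] with n hn w hw
    rw [dist_comm, Real.dist_eq]
    exact (hv _ _).trans_lt (hn w hw)
  refine ⟨ψ, hψ, fun w => v (g w), hunif.continuousOn (Frequently.of_forall fun n => ?_), hunif⟩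
  exact (continuous_chordalHeight.comp (hf.iterate _)).continuousOn

theorem compl_escapingSet_mem_nhds {f : ℂ → ℂ} (hf : Continuous f) {z : ℂ}
    (hz : z ∈ fatouSet f) (hzI : z ∉ escapingSet f) : (escapingSet f)ᶜ ∈ 𝓝 z := by
  obtain ⟨δ, hδ, hn⟩ := exists_subseq_tendstoUniformlyOn_chordalHeight hf hz
  have hzI' : ¬ Tendsto (fun n => ‖f^[n] z‖) atTop atTop := hzI
  rw [Filter.tendsto_atTop] at hzI'
  push Not at hzI'
  obtain ⟨B, hB⟩ := hzI'
  obtain ⟨φ, hφ, hφB⟩ := extraction_of_frequently_atTop hB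
  obtain ⟨ψ, hψ, v, hvc, hv⟩ := hn φ hφ
  set b := chordalHeight (|B| : ℝ) with hb
  have hb0 : 0 < b := chordalHeight_pos _
  have hvz : b ≤ v z := by
    refine ge_of_tendsto' (hv.tendsto_at (mem_closedBall_self hδ.le)) fun n => ?_
    refine chordalHeight_le_of_norm_le ?_
    have h1 : ‖f^[φ (ψ n)] z‖ < B := hφB (ψ n)
    rw [Complex.norm_real, Real.norm_eq_abs, abs_abs]
    exact h1.le.trans (le_abs_self B)
  have hmem : closedBall z δ ∈ 𝓝 z := closedBall_mem_nhds z hδ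
  filter_upwards [hmem, (hvc.continuousAt hmem).eventually (lt_mem_nhds (hb0.trans_le hvz))]
    with w hw hvw hwI
  have h1 := tendsto_chordalHeight ((show Tendsto _ _ _ from hwI).comp
    (hφ.tendsto_atTop.comp hψ.tendsto_atTop))
  exact hvw.ne (tendsto_nhds_unique h1 (hv.tendsto_at hw))

theorem norm_le_sq_of_one_le_norm {g : ℂ → ℂ} {z w : ℂ} {δ : ℝ} (hδ : 0 < δ)
    (hg : DifferentiableOn ℂ g (ball z δ)) (h1 : ∀ w ∈ ball z δ, 1 ≤ ‖g w‖)
    (hw : w ∈ ball z (δ / 5)) : ‖g z‖ ≤ ‖g w‖ ^ 2 := by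
  have hwδ : w ∈ ball z δ := ball_subset_ball (by linarith) hw
  obtain ⟨L, hLd, hL⟩ := exists_differentiableOn_log
    (isSimplyConnected_of_convex (convex_ball z δ) ⟨z, mem_ball_self hδ⟩) isOpen_ball hg
    fun x hx h0 => by
      have := h1 x hx
      rw [h0, norm_zero] at this
      linarith
  have hre : ∀ x ∈ ball z δ, ‖g x‖ = Real.exp (L x).re := fun x hx => by
    rw [← hL x hx, Complex.norm_exp]
  have hre0 : ∀ x ∈ ball z δ, 0 ≤ (L x).re := fun x hx => by
    have := h1 x hx
    rwa [hre x hx, Real.one_le_exp_iff] at this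
  have hzδ := mem_ball_self (x := z) hδ
  rw [hre z hzδ, hre w hwδ, ← Real.exp_nat_mul, Real.exp_le_exp]
  push_cast
  rcases (hre0 z hzδ).eq_or_lt with h | h
  · rw [← h]
    linarith [hre0 w hwδ]
  set H : ℂ → ℂ := fun t => L z - L (z + t) with hH
  have hmaps : MapsTo (fun t : ℂ => z + t) (ball 0 δ) (ball z δ) := by
    intro t ht
    simpa [dist_eq_norm] using ht
  have hHd : DifferentiableOn ℂ H (ball 0 δ) :=
    (hLd.comp (by fun_prop) hmaps).const_sub _
  have hwt : ‖w - z‖ < δ / 5 := by simpa [dist_eq_norm] using hw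
  have hbc := Complex.borelCaratheodory_zero (f := H) (M := (L z).re) (R := δ) (z := w - z) h hHd
    (fun t ht => by
      have := hre0 _ (hmaps ht)
      simp only [hH, mem_ofPred_eq, Complex.sub_re]
      linarith) hδ (by simp; linarith) (by simp [hH])
  have h2 : 2 * (L z).re * ‖w - z‖ / (δ - ‖w - z‖) ≤ (L z).re / 2 := by
    rw [div_le_iff₀ (by linarith)]
    nlinarith
  have h3 := (Complex.re_le_norm _).trans (hbc.trans h2)
  simp only [hH, add_sub_cancel, Complex.sub_re] at h3
  linarith

theorem escapingSet_mem_nhds {f : ℂ → ℂ} (hf : Differentiable ℂ f) {z : ℂ}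
    (hz : z ∈ fatouSet f) (hzI : z ∈ escapingSet f) : escapingSet f ∈ 𝓝 z := by
  obtain ⟨δ, hδ, hn⟩ := exists_subseq_tendstoUniformlyOn_chordalHeight hf.continuous hz
  have hzI' : Tendsto (fun n => ‖f^[n] z‖) atTop atTop := hzI
  have key : ∃ k : ℕ, ∀ᶠ n in atTop, ∀ w ∈ ball z (1 / (k + 1)), 1 ≤ ‖f^[n] w‖ := by
    by_contra! hcon
    have hfr : ∀ k : ℕ, ∃ᶠ n in atTop, ∃ w ∈ ball z (1 / ((k : ℝ) + 1)), ‖f^[n] w‖ < 1 := by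
      intro k
      refine (hcon k).mono fun n h => ?_
      simpa using h
    obtain ⟨φ, hφ, hφw⟩ := extraction_forall_of_frequently hfr
    choose w hwball hw1 using hφw
    obtain ⟨ψ, hψ, v, hvc, hv⟩ := hn φ hφ
    have hwz : Tendsto w atTop (𝓝 z) := by
      rw [tendsto_iff_dist_tendsto_zero]
      exact squeeze_zero (fun _ => dist_nonneg) (fun n => (mem_ball.1 (hwball n)).le)
        tendsto_one_div_add_atTop_nhds_zero_nat
    have hvz : v z = 0 := tendsto_nhds_unique (hv.tendsto_at (mem_closedBall_self hδ.le))
      (tendsto_chordalHeight (hzI'.comp (hφ.tendsto_atTop.comp hψ.tendsto_atTop)))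
    have hmem : closedBall z δ ∈ 𝓝 z := closedBall_mem_nhds z hδ
    have hlim : Tendsto (fun n => chordalHeight (f^[φ (ψ n)] (w (ψ n)))) atTop (𝓝 (v z)) := by
      exact tendsto_comp_of_locally_uniform_limit
        (F := fun n x => chordalHeight (f^[φ (ψ n)] x)) (hvc.continuousAt hmem)
        (hwz.comp hψ.tendsto_atTop) fun u hu => ⟨_, hmem, hv u hu⟩
    rw [hvz] at hlim
    have := ge_of_tendsto' hlim (fun n => chordalHeight_le_of_norm_le (v := 1)
      (by simpa using (hw1 (ψ n)).le))
    exact absurd this (not_le.2 (chordalHeight_pos 1))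
  obtain ⟨k, hk⟩ := key
  have hδk : (0 : ℝ) < 1 / (k + 1) := by positivity
  filter_upwards [ball_mem_nhds z (by positivity : (0 : ℝ) < 1 / (k + 1) / 5)] with w hw
  have h2 : Tendsto (fun n => ‖f^[n] w‖ ^ 2) atTop atTop := by
    refine tendsto_atTop_mono' _ ?_ hzI'
    filter_upwards [hk] with n hn
    exact norm_le_sq_of_one_le_norm hδk (hf.iterate n).differentiableOn hn hw
  have h3 := Real.tendsto_sqrt_atTop.comp h2
  refine h3.congr fun n => ?_
  simp [Real.sqrt_sq]

theorem juliaSet_nonempty {f : ℂ → ℂ} (hf : Differentiable ℂ f) {p z : ℂ} (hp : f p = p)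
    (hz : z ∈ escapingSet f) : (juliaSet f).Nonempty := by
  by_contra hne
  have hF : ∀ w, w ∈ fatouSet f := by
    intro w
    by_contra hw
    exact hne ⟨w, hw⟩
  have hclopen : IsClopen (escapingSet f) := by
    refine ⟨⟨isOpen_iff_mem_nhds.2 fun w hw => ?_⟩, isOpen_iff_mem_nhds.2 fun w hw => ?_⟩
    · exact compl_escapingSet_mem_nhds hf.continuous (hF w) hw
    · exact escapingSet_mem_nhds hf (hF w) hw
  rcases isClopen_iff.1 hclopen with h | h
  · rw [h] at hz
    exact hz
  · have hpI : Tendsto (fun n => ‖f^[n] p‖) atTop atTop := by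
      have : p ∈ escapingSet f := h ▸ mem_univ p
      exact this
    simp only [Function.iterate_fixed hp] at hpI
    exact not_tendsto_const_atTop _ _ hpI

theorem isOpen_fatouSet (f : ℂ → ℂ) : IsOpen (fatouSet f) := by
  refine isOpen_iff_mem_nhds.2 fun z ⟨U, hU, h⟩ => ?_
  filter_upwards [eventually_mem_nhds_iff.2 hU] with w hw
  exact ⟨U, hw, h⟩

theorem mapsTo_fatouSet {f : ℂ → ℂ} (hf : Differentiable ℂ f) (hnc : ¬ ∃ c, ∀ z, f z = c) :
    MapsTo f (fatouSet f) (fatouSet f) := by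
  rintro z ⟨U, hU, h⟩
  obtain ⟨δ, hδ, hball⟩ := Metric.nhds_basis_closedBall.mem_iff.1 hU
  have hV : f '' closedBall z δ ∈ 𝓝 (f z) := by
    have han : AnalyticOnNhd ℂ f univ := fun w _ => hf.analyticAt w
    rcases (hf.analyticAt z).eventually_constant_or_nhds_le_map_nhds with hc | hc
    · refine absurd ⟨f z, fun w => ?_⟩ hnc
      exact congrFun (han.eq_of_eventuallyEq (g := fun _ => f z) analyticOnNhd_const hc) w
    · exact hc (image_mem_map (closedBall_mem_nhds z hδ))
  have hsec : ∀ w, ∃ u, w ∈ f '' closedBall z δ → u ∈ closedBall z δ ∧ f u = w := by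
    intro w
    by_cases hw : w ∈ f '' closedBall z δ
    · obtain ⟨u, hu⟩ := hw
      exact ⟨u, fun _ => hu⟩
    · exact ⟨0, fun hw' => absurd hw' hw⟩
  choose s hs using hsec
  refine ⟨_, hV, fun φ hφ => ?_⟩
  obtain ⟨ψ, hψ, g, hg⟩ := h (fun n => φ n + 1) fun a b hab => by simpa using hφ hab
  refine ⟨ψ, hψ, fun w => g (s w), fun K hK _ η hη => ?_⟩
  filter_upwards [hg _ hball (isCompact_closedBall z δ) η hη] with n hn w hw
  have h1 := hn (s w) (hs w (hK hw)).1
  rwa [Function.iterate_succ_apply, (hs w (hK hw)).2] at h1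

/-- The logarithmic derivative of the iterates is bounded on discs in a Fatou set with simply
connected components. -/
theorem norm_deriv_iterate_mul_le {f : ℂ → ℂ} (hf : Differentiable ℂ f)
    (hnc : ¬ ∃ c, ∀ z, f z = c) (hF : NoMultiplyConnectedFatouComponent f) {p : ℂ}
    (hp : p ∈ juliaSet f) {z : ℂ} {δ : ℝ} (hδ : 0 < δ) (hball : ball z δ ⊆ fatouSet f) (n : ℕ) :
    ‖deriv f^[n] z‖ * δ ≤ 192 * Real.pi * ‖f^[n] z - p‖ := by
  by_contra! hlt
  have hzF : f^[n] z ∈ fatouSet f :=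
    (mapsTo_fatouSet hf hnc).iterate n (hball (mem_ball_self hδ))
  set U := connectedComponentIn (fatouSet f) (f^[n] z) with hU
  have hUF : U ⊆ fatouSet f := connectedComponentIn_subset _ _
  have hUo : IsOpen U := (isOpen_fatouSet f).connectedComponentIn
  have hmaps : MapsTo f^[n] (ball z δ) U := by
    rw [mapsTo_iff_image_subset]
    refine IsPreconnected.subset_connectedComponentIn ?_ ⟨z, mem_ball_self hδ, rfl⟩ ?_
    · exact (convex_ball z δ).isPreconnected.image _ (hf.iterate n).continuous.continuousOn
    · exact image_subset_iff.2 fun w hw => (mapsTo_fatouSet hf hnc).iterate n (hball hw)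
  obtain ⟨L, hLd, hL⟩ := exists_differentiableOn_log (g := fun w => w - p) (hF _ hzF) hUo
    (by fun_prop) fun w hw h0 => hp (sub_eq_zero.1 h0 ▸ hUF hw)
  set h : ℂ → ℂ := fun w => L (f^[n] w) with hh
  have hhd : DifferentiableOn ℂ h (ball z δ) :=
    hLd.comp (hf.iterate n).differentiableOn hmaps
  have hne : f^[n] z - p ≠ 0 := by
    rw [← hL _ (hmaps (mem_ball_self hδ))]
    exact Complex.exp_ne_zero _
  have hne' : 0 < ‖f^[n] z - p‖ := norm_pos_iff.2 hne
  have hder : deriv h z = deriv f^[n] z / (f^[n] z - p) :=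
    (hasDerivAt_of_exp_eq (g := fun w => f^[n] w - p) isOpen_ball hhd.continuousOn
      (fun w hw => hL _ (hmaps hw)) (mem_ball_self hδ)
      (((hf.iterate n) z).hasDerivAt.sub_const p)).deriv
  have hbig : 2 * Real.pi < ‖deriv h z‖ * δ / 96 := by
    rw [hder, norm_div, lt_div_iff₀ (by norm_num), div_mul_eq_mul_div, lt_div_iff₀ hne']
    linarith
  have hd0 : deriv h z ≠ 0 := by
    intro h0
    rw [h0, norm_zero] at hbig
    linarith [Real.pi_pos]
  obtain ⟨v, hv⟩ := exists_ball_subset_image_of_deriv hδ hhd hd0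
  obtain ⟨a, ha, hav⟩ := hv (mem_ball_self (by linarith [Real.pi_pos]))
  have hmem : v + 2 * Real.pi * Complex.I ∈ ball v (‖deriv h z‖ * δ / 96) := by
    simpa [dist_eq_norm, abs_of_pos Real.pi_pos] using hbig
  obtain ⟨b, hb, hbv⟩ := hv hmem
  have hab : f^[n] a = f^[n] b := by
    have h1 := hL _ (hmaps ha)
    have h2 := hL _ (hmaps hb)
    simp only [hh] at hav hbv
    rw [hav] at h1
    rw [hbv, Complex.exp_periodic v, h1] at h2
    exact sub_left_injective h2
  have h3 : h a = h b := congrArg L hab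
  rw [hav, hbv, left_eq_add] at h3
  exact Complex.two_pi_I_ne_zero h3

theorem pow_mul_norm_iterate_le {f : ℂ → ℂ} (hf : Differentiable ℂ f) {X : Set ℂ} {R σ ε : ℝ}
    (hR : 1 < R) (hσ : 0 < σ) (hε : 0 < ε) (hX : ∀ z ∈ X, R ≤ ‖z‖) (hXg : X ⊆ goodSet f σ ε)
    (hm : MapsTo f X X) {z : ℂ} (hz : z ∈ X) (n : ℕ) :
    (R ^ σ) ^ n * ‖f^[n] z‖ ≤ ‖z‖ * ‖deriv f^[n] z‖ := by
  induction n with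
  | zero => simp
  | succ n ih =>
    set w := f^[n] z with hw
    have hwX : w ∈ X := hm.iterate n hz
    have hwR := hX w hwX
    obtain ⟨h1, h2⟩ := hXg hwX
    have hfw : 0 < ‖f w‖ := lt_of_lt_of_le (by nlinarith) h2
    have h3 : R ^ σ * ‖f w‖ ≤ ‖w‖ * ‖deriv f w‖ := by
      rw [norm_div, norm_mul] at h1
      rw [← le_div_iff₀ hfw]
      exact (Real.rpow_le_rpow (by linarith) hwR hσ.le).trans h1
    have h4 : deriv f^[n + 1] z = deriv f w * deriv f^[n] z := by
      rw [Function.iterate_succ']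
      exact deriv_comp z (hf _) ((hf.iterate n) z)
    rw [Function.iterate_succ_apply', ← hw, h4, norm_mul, pow_succ, mul_assoc]
    calc (R ^ σ) ^ n * (R ^ σ * ‖f w‖) ≤ (R ^ σ) ^ n * (‖w‖ * ‖deriv f w‖) := by gcongr
      _ = ((R ^ σ) ^ n * ‖w‖) * ‖deriv f w‖ := by ring
      _ ≤ (‖z‖ * ‖deriv f^[n] z‖) * ‖deriv f w‖ := by gcongr
      _ = _ := by ring

theorem subset_juliaSet {f : ℂ → ℂ} (hf : Differentiable ℂ f) (hnc : ¬ ∃ c, ∀ z, f z = c)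
    (hF : NoMultiplyConnectedFatouComponent f) (hJ : (juliaSet f).Nonempty) {X : Set ℂ}
    {R σ ε : ℝ} (hR : 1 < R) (hσ : 0 < σ) (hε : 0 < ε) (hX : ∀ z ∈ X, R ≤ ‖z‖)
    (hXg : X ⊆ goodSet f σ ε) (hm : MapsTo f X X) : X ⊆ juliaSet f := by
  intro z hz hzF
  obtain ⟨p, hp⟩ := hJ
  obtain ⟨δ, hδ, hball⟩ := Metric.isOpen_iff.1 (isOpen_fatouSet f) z hzF
  have hR' : 1 < R ^ σ := Real.one_lt_rpow hR hσ
  obtain ⟨n, hn⟩ := pow_unbounded_of_one_lt (‖z‖ * (192 * Real.pi * (1 + ‖p‖)) / δ) hR'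
  rw [div_lt_iff₀ hδ] at hn
  have h1 := pow_mul_norm_iterate_le hf hR hσ hε hX hXg hm hz n
  have h2 := norm_deriv_iterate_mul_le hf hnc hF hp hδ hball n
  have h3 : 1 < ‖f^[n] z‖ := hR.trans_le (hX _ (hm.iterate n hz))
  have h4 : ‖f^[n] z - p‖ ≤ (1 + ‖p‖) * ‖f^[n] z‖ := by
    nlinarith [norm_sub_le (f^[n] z) p, norm_nonneg p]
  have h5 : (R ^ σ) ^ n * δ * ‖f^[n] z‖ ≤
      ‖z‖ * (192 * Real.pi * (1 + ‖p‖)) * ‖f^[n] z‖ := by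
    calc (R ^ σ) ^ n * δ * ‖f^[n] z‖ = ((R ^ σ) ^ n * ‖f^[n] z‖) * δ := by ring
      _ ≤ (‖z‖ * ‖deriv f^[n] z‖) * δ := by gcongr
      _ = ‖z‖ * (‖deriv f^[n] z‖ * δ) := by ring
      _ ≤ ‖z‖ * (192 * Real.pi * ((1 + ‖p‖) * ‖f^[n] z‖)) := by
        refine mul_le_mul_of_nonneg_left (h2.trans ?_) (norm_nonneg z)
        gcongr
      _ = _ := by ring
  have h6 := le_of_mul_le_mul_right h5 (by linarith)
  linarith

theorem not_const_of_logMeasure_diff_goodSet_lt_top {f : ℂ → ℂ} {σ ε : ℝ} (hε : 0 < ε)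
    (hyp : logMeasure (Delta \ goodSet f σ ε) < ⊤) : ¬ ∃ c, ∀ z, f z = c := by
  rintro ⟨c, hc⟩
  refine hyp.ne (logMeasure_eq_top_of_norm_ge (R := ‖c‖ + 1) fun z hz => ?_)
  have := norm_nonneg c
  refine ⟨show 1 ≤ ‖z‖ by linarith, fun hg => ?_⟩
  have h1 := hg.2
  rw [hc z] at h1
  nlinarith

theorem escaping_and_julia_positive_measure
    (f : ℂ → ℂ) (hf : Differentiable ℂ f) (ρ ε : ℝ)
    (hord : entireOrder f = (ρ : EReal)) (hε : 0 < ε)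
    (hyp : logArea {z : ℂ | z ∈ Delta ∧
        (‖z * deriv f z / f z‖ < ‖z‖ ^ (ρ / 2 + ε) ∨ ‖f z‖ < (1 + ε) * ‖z‖)} < ⊤) :
    logArea (Delta \ escapingSet f) < ⊤ ∧ 0 < volume (escapingSet f) ∧
      (NoMultiplyConnectedFatouComponent f →
        logArea (Delta \ (escapingSet f ∩ juliaSet f)) < ⊤ ∧
          0 < volume (escapingSet f ∩ juliaSet f)) := by
  have hyp' : logMeasure (Delta \ goodSet f (ρ / 2 + ε) ε) < ⊤ := by
    rw [logMeasure_apply]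
    convert hyp using 2
    ext z
    simp only [goodSet, Set.mem_sdiff, mem_ofPred_eq, not_and_or, not_le]
  have hnc := not_const_of_logMeasure_diff_goodSet_lt_top hε hyp'
  have hρ := (order_nonneg_or_const hf hord).resolve_right hnc
  obtain ⟨R, hR, X, hXR, hXg, hm, hX⟩ := exists_invariant_subset_goodSet hf hρ hε hord hyp'
  have hXI : X ⊆ escapingSet f := subset_escapingSet hR hε hXR (fun z hz => (hXg hz).2) hm
  have hmono : ∀ S, X ⊆ S → logMeasure (Delta \ S) < ⊤ := fun S hS =>
    (measure_mono (sdiff_subset_sdiff_right hS)).trans_lt hX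
  refine ⟨?_, volume_pos_of_logMeasure_diff_lt_top (hmono _ hXI), fun hF => ?_⟩
  · rw [← logMeasure_apply]
    exact hmono _ hXI
  obtain ⟨p, hp⟩ := exists_fixed_point hf hε hord hyp'
  obtain ⟨z, hz⟩ := nonempty_of_measure_ne_zero
    (volume_pos_of_logMeasure_diff_lt_top (hmono _ hXI)).ne'
  have hXJ : X ⊆ juliaSet f := subset_juliaSet hf hnc hF (juliaSet_nonempty hf hp hz) hR
    (by linarith) hε hXR hXg hm
  have hXIJ := hmono _ (subset_inter hXI hXJ)
  refine ⟨?_, volume_pos_of_logMeasure_diff_lt_top hXIJ⟩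
  rwa [← logMeasure_apply]
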